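/- arXiv:0905.1885 — 7 statements merged into one kernel-verified Lean document; each statement's English description precedes it below -/
import Mathlib

section
/- Let p be an odd prime, let G = Z_{p^{λ_1}} × ⋯ × Z_{p^{λ_n}} with 0 < λ_1 < λ_2 < ⋯ < λ_n, and let H = Z_{p^{μ_1}} × ⋯ × Z_{p^{μ_m}} with 0 < μ_1 < μ_2 < ⋯ < μ_m and m ≤ n. Then there exists an order isomorphism (inclusion-preserving bijection) between the set of characteristic subgroups of G and the set of characteristic subgroups of H, each ordered by inclusion, if and only if one of the following holds: (i) n = m and λ_i = μ_i for all i; (ii) n = 2, m = 1, (λ_1, λ_2) = (k, k+1) and μ_1 = 2k+1 for some natural number k ≥ 1; or (iii) n = 3, m = 2, (λ_1, λ_2, λ_3) = (1, 2, 4) and (μ_1, μ_2) = (2, 5). -/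
/-- A subgroup is characteristic if it is mapped onto itself by every automorphism. -/
def IsCharSub {G : Type*} [AddGroup G] (H : AddSubgroup G) : Prop :=
  ∀ φ : AddAut G, AddSubgroup.map φ.toAddMonoidHom H = H

/-- Points `(c, k)` with `1 ≤ k` and `c + k ∈ S`, encoding the element `p ^ c` of order `p ^ k`
in the cyclic factor of order `p ^ (c + k)`. -/
@[ext]
structure LevelPoint (S : Set ℕ) where
  c : ℕ
  k : ℕ
  one_le : 1 ≤ k
  mem : c + k ∈ S

namespace LevelPoint

instance (S : Set ℕ) : PartialOrder (LevelPoint S) where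
  le x y := y.c ≤ x.c ∧ x.k ≤ y.k
  le_refl _ := ⟨le_rfl, le_rfl⟩
  le_trans _ _ _ h h' := ⟨h'.1.trans h.1, h.2.trans h'.2⟩
  le_antisymm _ _ h h' := LevelPoint.ext (h'.1.antisymm h.1) (h.2.antisymm h'.2)

theorem le_def {S : Set ℕ} {x y : LevelPoint S} : x ≤ y ↔ y.c ≤ x.c ∧ x.k ≤ y.k := Iff.rfl

instance (S : Set ℕ) [Finite S] : Finite (LevelPoint S) :=
  Finite.of_injective
    (fun x => (⟨⟨x.c + x.k, x.mem⟩, ⟨x.c, by simp⟩⟩ : Σ s : S, Fin (s.1 + 1)))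
    fun x y hxy => by
      rw [Sigma.mk.injEq, Subtype.mk.injEq] at hxy
      have hc := (Fin.heq_ext_iff (congrArg (· + 1) hxy.1)).1 hxy.2
      exact LevelPoint.ext hc (by simp only at hc; omega)

end LevelPoint

section ZModPrimePow

variable {p : ℕ}

theorem zmod_prime_pow_pow_self (a : ℕ) : ((p : ZMod (p ^ a)) ^ a) = 0 := by
  have := ZMod.natCast_self (p ^ a)
  exact_mod_cast this

theorem zmod_prime_pow_exists_eq_pow_mul_unit (hp : p.Prime) (a : ℕ) (z : ZMod (p ^ a)) :
    ∃ v ≤ a, ∃ u : (ZMod (p ^ a))ˣ, z = (p : ZMod (p ^ a)) ^ v * u := by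
  have : NeZero (p ^ a) := ⟨pow_ne_zero _ hp.ne_zero⟩
  by_cases hz : z = 0
  · exact ⟨a, le_rfl, 1, by rw [zmod_prime_pow_pow_self, hz, zero_mul]⟩
  have hval : z.val ≠ 0 := by rwa [Ne, ZMod.val_eq_zero]
  obtain ⟨v, w, hw, hvw⟩ := Nat.exists_eq_pow_mul_and_not_dvd hval p hp.ne_one
  have hcop : Nat.Coprime w (p ^ a) :=
    (Nat.Coprime.pow_right a ((hp.coprime_iff_not_dvd.2 hw).symm))
  have hzw : z = (p : ZMod (p ^ a)) ^ v * (w : ZMod (p ^ a)) := by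
    rw [← ZMod.natCast_zmod_val z, hvw]; push_cast; rfl
  refine ⟨v, ?_, ZMod.unitOfCoprime w hcop, by rw [ZMod.coe_unitOfCoprime]; exact hzw⟩
  by_contra! h
  apply hz
  rw [hzw, ← Nat.sub_add_cancel h.le, pow_add, zmod_prime_pow_pow_self, mul_zero, zero_mul]

theorem zmod_prime_pow_pow_dvd_pow (hp : p.Prime) {a c v : ℕ} (hv : v < a)
    (h : (p : ZMod (p ^ a)) ^ c ∣ (p : ZMod (p ^ a)) ^ v) : c ≤ v := by
  by_contra! hc
  have h0 : (p : ZMod (p ^ a)) ^ (a - 1) = 0 := by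
    obtain ⟨w, hw⟩ := h
    have h1 : a - 1 = (a - 1 - v) + v := by omega
    have h2 : (a - 1 - v) + c = (c - v - 1) + a := by omega
    rw [h1, pow_add, hw, ← mul_assoc, ← pow_add, h2, pow_add, zmod_prime_pow_pow_self,
      mul_zero, zero_mul]
  have h1 : ((p ^ (a - 1) : ℕ) : ZMod (p ^ a)) = 0 := by exact_mod_cast h0
  rw [ZMod.natCast_eq_zero_iff, Nat.pow_dvd_pow_iff_le_right hp.one_lt] at h1
  omega

theorem zmod_prime_pow_dvd_of_pow_mul_eq_zero (hp : p.Prime) {a x : ℕ} {z : ZMod (p ^ a)}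
    (h : (p : ZMod (p ^ a)) ^ x * z = 0) : (p : ZMod (p ^ a)) ^ (a - x) ∣ z := by
  obtain ⟨v, hv, u, rfl⟩ := zmod_prime_pow_exists_eq_pow_mul_unit hp a z
  apply Dvd.dvd.mul_right
  apply pow_dvd_pow
  by_contra! hlt
  have h0 : (p : ZMod (p ^ a)) ^ (x + v) = 0 := by
    rw [← mul_assoc, ← pow_add] at h
    exact (Units.mul_left_eq_zero u).1 h
  have := zmod_prime_pow_pow_dvd_pow hp (a := a) (c := a) (v := x + v) (by omega)
    (by rw [h0]; exact dvd_zero _)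
  omega

end ZModPrimePow

section CharacteristicSubgroups

variable {p n : ℕ} {lam : Fin n → ℕ}

theorem IsCharSub.apply_mem {G : Type*} [AddGroup G] {A : AddSubgroup G} (hA : IsCharSub A)
    (φ : AddAut G) {z : G} (hz : z ∈ A) : φ z ∈ A := by
  have h : φ z ∈ AddSubgroup.map φ.toAddMonoidHom A := ⟨z, hz, rfl⟩
  rwa [hA φ] at h

theorem isCharSub_of_apply_mem {G : Type*} [AddGroup G] {A : AddSubgroup G}
    (h : ∀ f : G →+ G, ∀ z ∈ A, f z ∈ A) : IsCharSub A := by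
  intro φ
  apply le_antisymm
  · rintro _ ⟨z, hz, rfl⟩
    exact h _ z hz
  · intro z hz
    exact ⟨φ.symm z, h (AddEquiv.toAddMonoidHom φ.symm) z hz, φ.apply_symm_apply z⟩

theorem IsCharSub.single_mem (hp : p.Prime) (hodd : p ≠ 2)
    {A : AddSubgroup (Π i : Fin n, ZMod (p ^ lam i))} (hA : IsCharSub A)
    {z : Π i : Fin n, ZMod (p ^ lam i)} (hz : z ∈ A) (i : Fin n) : Pi.single i (z i) ∈ A := by
  have hu : IsUnit (1 + Pi.single i 1 : Π i : Fin n, ZMod (p ^ lam i)) := by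
    rw [Pi.isUnit_iff]
    intro j
    by_cases hj : j = i
    · subst hj
      have h2 : IsUnit ((2 : ℕ) : ZMod (p ^ lam j)) := by
        rw [ZMod.isUnit_iff_coprime]
        exact Nat.Coprime.pow_right _ ((Nat.coprime_primes Nat.prime_two hp).2 hodd.symm)
      simpa [one_add_one_eq_two] using h2
    · simp [hj]
  obtain ⟨u, hu⟩ := hu
  have h := A.sub_mem (hA.apply_mem (AddAut.mulLeft u) hz) hz
  convert h using 1
  rw [AddAut.mulLeft_apply_apply, Units.smul_def, hu, smul_eq_mul]
  ext j
  by_cases hj : j = i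
  · subst hj; simp; ring
  · simp [hj]

theorem single_mul_mem {A : AddSubgroup (Π i : Fin n, ZMod (p ^ lam i))} (hp : p.Prime)
    {i : Fin n} {x : ZMod (p ^ lam i)} (hx : Pi.single i x ∈ A) (r : ZMod (p ^ lam i)) :
    Pi.single i (x * r) ∈ A := by
  have : NeZero (p ^ lam i) := ⟨pow_ne_zero _ hp.ne_zero⟩
  have h := A.nsmul_mem hx r.val
  rwa [← Pi.single_smul, nsmul_eq_mul, ZMod.natCast_zmod_val, mul_comm] at h

theorem IsCharSub.single_pow_mem (hp : p.Prime)
    {A : AddSubgroup (Π i : Fin n, ZMod (p ^ lam i))} (hA : IsCharSub A) {i j : Fin n} {c v : ℕ}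
    (hvc : v ≤ c) (hle : lam i + v ≤ lam j + c)
    (h : Pi.single j ((p : ZMod (p ^ lam j)) ^ v) ∈ A) :
    Pi.single i ((p : ZMod (p ^ lam i)) ^ c) ∈ A := by
  by_cases hij : i = j
  · subst hij
    have := single_mul_mem hp h ((p : ZMod (p ^ lam i)) ^ (c - v))
    rwa [← pow_add, Nat.add_sub_cancel' hvc] at this
  let f : ZMod (p ^ lam j) →+ ZMod (p ^ lam i) :=
    ZMod.lift (p ^ lam j) ⟨(AddMonoidHom.mulRight ((p : ZMod (p ^ lam i)) ^ (c - v))).comp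
      (Int.castAddHom _), by
        have : lam j + (c - v) = (lam j + (c - v) - lam i) + lam i := by omega
        simp only [AddMonoidHom.coe_comp, Function.comp_apply, Int.coe_castAddHom,
          AddMonoidHom.coe_mulRight]
        push_cast
        rw [← pow_add, this, pow_add, zmod_prime_pow_pow_self, mul_zero]⟩
  have hf : f ((p : ZMod (p ^ lam j)) ^ v) = (p : ZMod (p ^ lam i)) ^ c := by
    have : ((p : ZMod (p ^ lam j)) ^ v) = (((p : ℤ) ^ v : ℤ) : ZMod (p ^ lam j)) := by
      push_cast; rfl
    rw [this, ZMod.lift_coe]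
    simp only [AddMonoidHom.coe_comp, Function.comp_apply, Int.coe_castAddHom,
          AddMonoidHom.coe_mulRight]
    push_cast
    rw [← pow_add, Nat.add_sub_cancel' hvc]
  let g : (Π i : Fin n, ZMod (p ^ lam i)) →+ (Π i : Fin n, ZMod (p ^ lam i)) :=
    (AddMonoidHom.single (fun i => ZMod (p ^ lam i)) i).comp (f.comp (Pi.evalAddMonoidHom _ j))
  have hg : ∀ z, g z = Pi.single i (f (z j)) := fun z => rfl
  have hgg : ∀ z, g (g z) = 0 := fun z => by
    rw [hg, hg, Pi.single_eq_of_ne (Ne.symm hij), map_zero, Pi.single_zero]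
  let φ : AddAut (Π i : Fin n, ZMod (p ^ lam i)) :=
    { toFun := fun z => z + g z
      invFun := fun z => z - g z
      left_inv := fun z => by simp [hgg]
      right_inv := fun z => by simp [hgg]
      map_add' := fun x y => by rw [map_add]; abel }
  have h1 := A.sub_mem (hA.apply_mem φ h) h
  have h2 : φ (Pi.single j ((p : ZMod (p ^ lam j)) ^ v))
      = Pi.single j ((p : ZMod (p ^ lam j)) ^ v) + g (Pi.single j ((p : ZMod (p ^ lam j)) ^ v)) :=
    rfl
  rwa [h2, add_sub_cancel_left, hg, Pi.single_eq_same, hf] at h1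

/-- The point of `p ^ c` in the `i`-th cyclic factor. -/
def factorPoint (i : Fin n) (c : ℕ) (h : c < lam i) : LevelPoint (Set.range lam) :=
  ⟨c, lam i - c, by omega, i, by omega⟩

/-- The points of the generators `p ^ c` lying in a characteristic subgroup. -/
def charSubPoints (hp : p.Prime)
    (A : {A : AddSubgroup (Π i : Fin n, ZMod (p ^ lam i)) // IsCharSub A}) :
    LowerSet (LevelPoint (Set.range lam)) where
  carrier := {x | ∀ i, lam i = x.c + x.k → Pi.single i ((p : ZMod (p ^ lam i)) ^ x.c) ∈ A.1}
  lower' := by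
    intro y x hxy hy i hi
    obtain ⟨j, hj⟩ := y.mem
    have := LevelPoint.le_def.1 hxy
    exact A.2.single_pow_mem hp this.1 (by omega) (hy j hj)

theorem charSubPoints_le_iff (hp : p.Prime) (hodd : p ≠ 2)
    {A B : {A : AddSubgroup (Π i : Fin n, ZMod (p ^ lam i)) // IsCharSub A}} :
    charSubPoints hp A ≤ charSubPoints hp B ↔ A ≤ B := by
  constructor
  · intro h z hz
    rw [← Finset.univ_sum_single z]
    refine B.1.sum_mem fun i _ => ?_
    have hzi := A.2.single_mem hp hodd hz i
    obtain ⟨v, hv, u, hu⟩ := zmod_prime_pow_exists_eq_pow_mul_unit hp _ (z i)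
    rcases hv.lt_or_eq with hv | hv
    · have h1 : factorPoint i v hv ∈ charSubPoints hp A := by
        intro j hj
        have h2 := single_mul_mem hp hzi (↑u⁻¹ : ZMod (p ^ lam i))
        rw [hu, mul_assoc, Units.mul_inv, mul_one] at h2
        exact A.2.single_pow_mem hp le_rfl (by simp only [factorPoint] at hj ⊢; omega) h2
      have h2 := h h1 i (by simp only [factorPoint]; omega)
      rw [hu]
      exact single_mul_mem hp h2 _
    · rw [hu, hv, zmod_prime_pow_pow_self, zero_mul, Pi.single_zero]
      exact B.1.zero_mem
  · exact fun h x hx i hi => h (hx i hi)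

/-- The subgroup of tuples whose coordinates have all their points in `I`. -/
def pointsSubgroup (p : ℕ) (I : LowerSet (LevelPoint (Set.range lam))) :
    AddSubgroup (Π i : Fin n, ZMod (p ^ lam i)) where
  carrier := {z | ∀ i c, ∀ h : c < lam i, factorPoint i c h ∉ I →
    (p : ZMod (p ^ lam i)) ^ (c + 1) ∣ z i}
  add_mem' ha hb i c h hI := dvd_add (ha i c h hI) (hb i c h hI)
  zero_mem' _ _ _ _ := dvd_zero _
  neg_mem' ha i c h hI := (dvd_neg).2 (ha i c h hI)

theorem isCharSub_pointsSubgroup (hp : p.Prime) (I : LowerSet (LevelPoint (Set.range lam))) :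
    IsCharSub (pointsSubgroup p I) := by
  apply isCharSub_of_apply_mem
  intro f z hz i c hc hI
  rw [← Finset.univ_sum_single z, map_sum, Finset.sum_apply]
  refine Finset.dvd_sum fun j _ => ?_
  obtain ⟨v, hv, u, hu⟩ := zmod_prime_pow_exists_eq_pow_mul_unit hp _ (z j)
  have hsmul : ∀ (x : ℕ) (y : ZMod (p ^ lam j)),
      f (Pi.single j ((p : ZMod (p ^ lam j)) ^ x * y)) i
        = (p : ZMod (p ^ lam i)) ^ x * f (Pi.single j y) i := by
    intro x y
    have : (p : ZMod (p ^ lam j)) ^ x * y = (p ^ x) • y := by rw [nsmul_eq_mul]; push_cast; rfl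
    rw [this, Pi.single_smul, map_nsmul, Pi.smul_apply, nsmul_eq_mul]; push_cast; rfl
  rcases hv.lt_or_eq with hv | hv
  · have hjI : factorPoint j v hv ∈ I := by
      by_contra hjI
      have h1 := hz j v hv hjI
      rw [hu, Units.dvd_mul_right] at h1
      have := zmod_prime_pow_pow_dvd_pow hp hv h1
      omega
    have hnle : ¬ factorPoint i c hc ≤ factorPoint j v hv := fun hle => hI (I.lower hle hjI)
    rw [LevelPoint.le_def] at hnle
    simp only [factorPoint] at hnle
    by_cases hcv : c < v
    · rw [hu, hsmul]
      exact (pow_dvd_pow _ hcv).mul_right _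
    · have h0 : (p : ZMod (p ^ lam i)) ^ (lam j - v) * f (Pi.single j (z j)) i = 0 := by
        rw [← hsmul, hu, ← mul_assoc, ← pow_add, Nat.sub_add_cancel hv.le,
          zmod_prime_pow_pow_self, zero_mul, Pi.single_zero, map_zero, Pi.zero_apply]
      exact (pow_dvd_pow _ (by omega)).trans (zmod_prime_pow_dvd_of_pow_mul_eq_zero hp h0)
  · rw [hu, hv, zmod_prime_pow_pow_self, zero_mul, Pi.single_zero, map_zero, Pi.zero_apply]
    exact dvd_zero _

theorem charSubPoints_pointsSubgroup (hp : p.Prime) (hlam : StrictMono lam)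
    (I : LowerSet (LevelPoint (Set.range lam))) :
    charSubPoints hp ⟨pointsSubgroup p I, isCharSub_pointsSubgroup hp I⟩ = I := by
  ext x
  obtain ⟨i, hi⟩ := x.mem
  have hk := x.one_le
  have hx : x = factorPoint i x.c (by omega) :=
    LevelPoint.ext rfl (by simp only [factorPoint]; omega)
  constructor
  · intro h
    by_contra hxI
    have h1 := h i hi i x.c (by omega) (by rwa [← hx])
    rw [Pi.single_eq_same] at h1
    have := zmod_prime_pow_pow_dvd_pow hp (by omega) h1
    omega
  · intro h i' hi' j c hc hI
    obtain rfl : i' = i := hlam.injective (hi'.trans hi.symm)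
    by_cases hj : j = i'
    · subst hj
      rw [Pi.single_eq_same]
      apply pow_dvd_pow
      by_contra! hlt
      refine hI (I.lower ?_ h)
      rw [LevelPoint.le_def]
      simp only [factorPoint]
      omega
    · rw [Pi.single_eq_of_ne hj]
      exact dvd_zero _

/-- For odd `p`, characteristic subgroups correspond to lower sets of points. -/
noncomputable def charSubOrderIso (hp : p.Prime) (hodd : p ≠ 2) (hlam : StrictMono lam) :
    {A : AddSubgroup (Π i : Fin n, ZMod (p ^ lam i)) // IsCharSub A} ≃o
      LowerSet (LevelPoint (Set.range lam)) :=
  RelIso.ofSurjective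
    (OrderEmbedding.ofMapLEIff (charSubPoints hp) fun _ _ => charSubPoints_le_iff hp hodd)
    fun I => ⟨_, charSubPoints_pointsSubgroup hp hlam I⟩

end CharacteristicSubgroups

section LevelSequences

open Finset

/-- `ν 0 > ν 1 > ⋯ > ν (n - 1) > ν n = 0`. -/
structure IsLevelSeq (n : ℕ) (ν : ℕ → ℕ) : Prop where
  succ_lt : ∀ j < n, ν (j + 1) < ν j
  eq_zero : ν n = 0

namespace IsLevelSeq

variable {n : ℕ} {ν : ℕ → ℕ}

theorem lt (h : IsLevelSeq n ν) {i j : ℕ} (hij : i < j) (hj : j ≤ n) : ν j < ν i := by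
  induction j, hij using Nat.le_induction with
  | base => exact h.succ_lt i hj
  | succ j hij ih => exact (h.succ_lt j hj).trans (ih (by omega))

theorem le (h : IsLevelSeq n ν) {i j : ℕ} (hij : i ≤ j) (hj : j ≤ n) : ν j ≤ ν i := by
  rcases hij.eq_or_lt with rfl | hij
  · rfl
  · exact (h.lt hij hj).le

theorem pos (h : IsLevelSeq n ν) {j : ℕ} (hj : j < n) : 0 < ν j :=
  (Nat.zero_le _).trans_lt (h.succ_lt j hj)

theorem c_add_k_le (h : IsLevelSeq n ν) (x : LevelPoint (ν '' Set.Iio n)) :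
    x.c + x.k ≤ ν 0 := by
  obtain ⟨l, hl, hx⟩ := x.mem
  rw [← hx]
  exact h.le (Nat.zero_le l) (le_of_lt hl)

/-- The point of order `p` in the factor of level `j`. -/
def row (h : IsLevelSeq n ν) (j : ℕ) (hj : j < n) : LevelPoint (ν '' Set.Iio n) :=
  ⟨ν j - 1, 1, le_rfl, j, hj, by have := h.pos hj; omega⟩

theorem exists_eq_row (h : IsLevelSeq n ν) {x : LevelPoint (ν '' Set.Iio n)} (hx : x.k = 1) :
    ∃ l, ∃ hl : l < n, x = h.row l hl := by
  obtain ⟨l, hl, hlx⟩ := x.mem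
  exact ⟨l, hl, LevelPoint.ext (by simp only [row]; omega) hx⟩

end IsLevelSeq

/-- The point of order `p ^ k` in the largest factor. -/
def LevelPoint.col {n : ℕ} {ν : ℕ → ℕ} (hn : 0 < n) (k : ℕ) (hk : 1 ≤ k) (hkν : k ≤ ν 0) :
    LevelPoint (ν '' Set.Iio n) :=
  ⟨ν 0 - k, k, hk, 0, hn, by omega⟩

variable {n m : ℕ} {ν κ : ℕ → ℕ}

theorem IsLevelSeq.card_subtype (h : IsLevelSeq n ν) (Q : ℕ → ℕ → Prop)
    [∀ c k, Decidable (Q c k)] :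
    Nat.card {y : LevelPoint (ν '' Set.Iio n) // Q y.c y.k} =
      ∑ l ∈ range n, #{k ∈ Icc 1 (ν l) | Q (ν l - k) k} := by
  rw [← card_sigma, ← Fintype.card_coe, ← Nat.card_eq_fintype_card]
  symm
  refine Nat.card_eq_of_bijective
    (fun z => ⟨⟨ν z.1.1 - z.1.2, z.1.2, ?_, z.1.1, ?_, ?_⟩, ?_⟩) ⟨?_, ?_⟩
  · have := z.2; simp only [mem_sigma, mem_filter, mem_Icc] at this; exact this.2.1.1
  · have := z.2; simp only [mem_sigma, mem_range] at this; exact this.1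
  · have := z.2; simp only [mem_sigma, mem_filter, mem_Icc] at this; omega
  · have := z.2; simp only [mem_sigma, mem_filter] at this; exact this.2.2
  · rintro ⟨⟨l, k⟩, hz⟩ ⟨⟨l', k'⟩, hz'⟩ heq
    simp only [mem_sigma, mem_range, mem_filter, mem_Icc] at hz hz'
    have hc : ν l - k = ν l' - k' := congrArg (fun z => z.1.c) heq
    obtain rfl : k = k' := congrArg (fun z => z.1.k) heq
    have hl : l = l' := by
      rcases lt_trichotomy l l' with hlt | rfl | hlt
      · have := h.lt hlt hz'.1.le
        omega
      · rfl
      · have := h.lt hlt hz.1.le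
        omega
    subst hl
    rfl
  · rintro ⟨y, hy⟩
    obtain ⟨l, hl, hly⟩ := y.mem
    have hk := y.one_le
    have hc : ν l - y.k = y.c := by omega
    refine ⟨⟨⟨l, y.k⟩, ?_⟩, ?_⟩
    · simp only [mem_sigma, mem_range, mem_filter, mem_Icc]
      exact ⟨hl, ⟨hk, by omega⟩, by rwa [hc]⟩
    · exact Subtype.ext (LevelPoint.ext hc rfl)

theorem IsLevelSeq.card (h : IsLevelSeq n ν) :
    Nat.card (LevelPoint (ν '' Set.Iio n)) = ∑ l ∈ range n, ν l := by
  have := h.card_subtype (fun _ _ => True)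
  rw [Nat.card_congr (Equiv.subtypeUnivEquiv fun _ => trivial)] at this
  simpa using this

theorem IsLevelSeq.card_not_le (h : IsLevelSeq n ν) (x : LevelPoint (ν '' Set.Iio n)) :
    Nat.card {y // ¬ x ≤ y} =
      ∑ l ∈ range n, min (ν l) (max (ν l - x.c - 1) (x.k - 1)) := by
  have := h.card_subtype (fun c k => ¬ (c ≤ x.c ∧ x.k ≤ k))
  simp only [LevelPoint.le_def]
  rw [this]
  refine sum_congr rfl fun l _ => ?_
  have h1 : ({k ∈ Icc 1 (ν l) | ¬ (ν l - k ≤ x.c ∧ x.k ≤ k)} : Finset ℕ)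
      = Icc 1 (min (ν l) (max (ν l - x.c - 1) (x.k - 1))) := by
    ext k
    simp only [mem_filter, mem_Icc]
    have := x.one_le
    omega
  rw [h1, Nat.card_Icc, Nat.add_sub_cancel]

theorem IsLevelSeq.card_not_le_row (h : IsLevelSeq n ν) (j : ℕ) (hj : j < n) :
    Nat.card {y // ¬ h.row j hj ≤ y} = ∑ l ∈ range n, (ν l - ν j) := by
  rw [h.card_not_le]
  refine sum_congr rfl fun l _ => ?_
  have := h.pos hj
  simp only [row]
  omega

theorem IsLevelSeq.card_not_le_col (h : IsLevelSeq n ν) (hn : 0 < n) (k : ℕ) (hk : k + 1 ≤ ν 0) :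
    Nat.card {y // ¬ LevelPoint.col hn (k + 1) (by omega) hk ≤ y} =
      ∑ l ∈ range n, min (ν l) k := by
  rw [h.card_not_le]
  refine sum_congr rfl fun l hl => ?_
  have := h.le (Nat.zero_le l) (mem_range.1 hl).le
  simp only [LevelPoint.col]
  omega

theorem IsLevelSeq.sum_tsub_succ (h : IsLevelSeq n ν) {j : ℕ} (hj : j < n) :
    ∑ l ∈ range n, (ν l - ν (j + 1)) =
      ∑ l ∈ range n, (ν l - ν j) + (j + 1) * (ν j - ν (j + 1)) := by
  have h1 : ∀ l ∈ range n, ν l - ν (j + 1) =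
      (ν l - ν j) + if l ∈ range (j + 1) then ν j - ν (j + 1) else 0 := by
    intro l hl
    rw [mem_range] at hl
    have hs := h.succ_lt j hj
    split_ifs with hlj
    · have := h.le (Nat.lt_succ_iff.1 (mem_range.1 hlj)) hj.le
      omega
    · rw [mem_range] at hlj
      have := h.le (i := j + 1) (j := l) (by omega) hl.le
      omega
  rw [sum_congr rfl h1, sum_add_distrib, sum_ite_mem,
    inter_eq_right.2 (range_subset_range.2 (by omega)), sum_const, card_range, smul_eq_mul]

theorem IsLevelSeq.sum_tsub_zero (h : IsLevelSeq n ν) :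
    ∑ l ∈ range n, (ν l - ν 0) = 0 := by
  refine sum_eq_zero fun l hl => ?_
  have := h.le (Nat.zero_le l) (mem_range.1 hl).le
  omega

theorem sum_min_succ (n : ℕ) (ν : ℕ → ℕ) (k : ℕ) :
    ∑ l ∈ range n, min (ν l) (k + 1) = ∑ l ∈ range n, min (ν l) k + #{l ∈ range n | k < ν l} := by
  rw [card_filter, ← sum_add_distrib]
  refine sum_congr rfl fun l _ => ?_
  split_ifs <;> omega

theorem IsLevelSeq.sum_min_one (h : IsLevelSeq n ν) : ∑ l ∈ range n, min (ν l) 1 = n := by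
  conv_rhs => rw [← card_range n, card_eq_sum_ones]
  refine sum_congr rfl fun l hl => ?_
  have := h.pos (mem_range.1 hl)
  omega

theorem card_not_le_congr {α β : Type*} [Preorder α] [Preorder β] (φ : α ≃o β) (x : α) :
    Nat.card {y // ¬ x ≤ y} = Nat.card {y // ¬ φ x ≤ y} :=
  Nat.card_congr (φ.toEquiv.subtypeEquiv fun y => by simp)

/-- A level sequence is determined by its gaps and its sum. -/
theorem IsLevelSeq.eq_of_gaps (h : IsLevelSeq n ν) (h' : IsLevelSeq n κ)
    (hgap : ∀ j, j + 1 < n → ν j - ν (j + 1) = κ j - κ (j + 1))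
    (hsum : ∑ l ∈ range n, ν l = ∑ l ∈ range n, κ l) : ∀ j < n, ν j = κ j := by
  have h1 : ∀ j < n, (ν j : ℤ) - κ j = ν 0 - κ 0 := by
    intro j
    induction j with
    | zero => simp
    | succ j ih =>
      intro hj
      have := ih (by omega)
      have := hgap j hj
      have := h.succ_lt j (by omega)
      have := h'.succ_lt j (by omega)
      omega
  have h2 : (∑ l ∈ range n, ((ν l : ℤ) - κ l)) = 0 := by
    rw [sum_sub_distrib, sub_eq_zero]
    exact_mod_cast hsum
  rw [sum_congr rfl fun l hl => h1 l (mem_range.1 hl), sum_const, card_range, nsmul_eq_mul,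
    mul_eq_zero] at h2
  intro j hj
  have := h1 j hj
  omega

theorem OrderIso.not_least_of_two_minimal {α β : Type*} [PartialOrder α]
    [PartialOrder β] (φ : α ≃o β) {U : α → Prop} {U' : β → Prop} (hU : ∀ x, U x ↔ U' (φ x))
    {a b : α} (ha : U a) (hb : U b) (hab : ¬ a ≤ b) (hba : ¬ b ≤ a)
    (hmin : ∀ x, U x → a ≤ x ∨ b ≤ x)
    {z : β} (hz : U' z) (hleast : ∀ y, U' y → z ≤ y) :
    False := by
  have hza : φ.symm z ≤ a := (φ.symm_apply_le).2 (hleast _ ((hU a).1 ha))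
  have hzb : φ.symm z ≤ b := (φ.symm_apply_le).2 (hleast _ ((hU b).1 hb))
  rcases hmin (φ.symm z) ((hU _).2 (by simpa using hz)) with h | h
  · exact hab (h.trans hzb)
  · exact hba (h.trans hza)

theorem OrderIso.apply_eq_of_two_minimal {α β : Type*} [PartialOrder α]
    [PartialOrder β] (φ : α ≃o β) {U : α → Prop} {U' : β → Prop} (hU : ∀ x, U x ↔ U' (φ x))
    {a b : α} (ha : U a) (hb : U b) (hab : ¬ a ≤ b) (hba : ¬ b ≤ a)
    (hmin : ∀ x, U x → a ≤ x ∨ b ≤ x)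
    {a' b' : β} (ha' : U' a') (hb' : U' b')
    (hmin' : ∀ y, U' y → a' ≤ y ∨ b' ≤ y) :
    (φ a = a' ∧ φ b = b') ∨ (φ a = b' ∧ φ b = a') := by
  have key : ∀ z, U' z → ∀ x, (x = a ∨ x = b) → z ≤ φ x → φ x = z := by
    intro z hz x hx hzx
    have h1 : φ.symm z ≤ x := (φ.symm_apply_le).2 hzx
    have h2 : x ≤ φ.symm z := by
      rcases hx with rfl | rfl <;>
        rcases hmin (φ.symm z) ((hU _).2 (by simpa using hz)) with h | h
      · exact h
      · exact absurd (h.trans h1) hba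
      · exact absurd (h.trans h1) hab
      · exact h
    rw [h2.antisymm h1, φ.apply_symm_apply]
  have hne : φ a ≠ φ b := fun h => hab (φ.injective h).le
  have h1 : φ a = a' ∨ φ a = b' := (hmin' _ ((hU a).1 ha)).imp
    (key _ ha' _ (Or.inl rfl)) (key _ hb' _ (Or.inl rfl))
  have h2 : φ b = a' ∨ φ b = b' := (hmin' _ ((hU b).1 hb)).imp
    (key _ ha' _ (Or.inr rfl)) (key _ hb' _ (Or.inr rfl))
  grind

open LevelPoint

theorem IsLevelSeq.row_strictMono (h : IsLevelSeq n ν) :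
    StrictMono fun j : Fin n => h.row j j.2 := by
  intro i j hij
  have hlt := h.lt (i := i) (j := j) hij j.2.le
  have := h.pos j.2
  rw [lt_iff_le_not_ge, le_def, le_def]
  simp only [row]
  omega

theorem IsLevelSeq.not_col_two_le_iff (h : IsLevelSeq n ν) (hn : 0 < n) (hν : 2 ≤ ν 0)
    (y : LevelPoint (ν '' Set.Iio n)) : ¬ col hn 2 (by omega) hν ≤ y ↔ y.k = 1 := by
  have := h.c_add_k_le y
  have := y.one_le
  simp only [le_def, col]
  omega

theorem IsLevelSeq.range_row (h : IsLevelSeq n ν) :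
    Set.range (fun j : Fin n => h.row j j.2) = {y | y.k = 1} := by
  ext y
  constructor
  · rintro ⟨j, rfl⟩
    rfl
  · intro hy
    obtain ⟨l, hl, rfl⟩ := h.exists_eq_row hy
    exact ⟨⟨l, hl⟩, rfl⟩

theorem IsLevelSeq.sum_eq (h : IsLevelSeq n ν) (h' : IsLevelSeq m κ)
    (φ : LevelPoint (ν '' Set.Iio n) ≃o LevelPoint (κ '' Set.Iio m)) :
    ∑ l ∈ range n, ν l = ∑ l ∈ range m, κ l := by
  rw [← h.card, ← h'.card, Nat.card_congr φ.toEquiv]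

theorem IsLevelSeq.eq_of_apply_col_two (h : IsLevelSeq n ν) (h' : IsLevelSeq m κ)
    (φ : LevelPoint (ν '' Set.Iio n) ≃o LevelPoint (κ '' Set.Iio m)) (hn : 0 < n) (hm : 0 < m)
    (hν : 2 ≤ ν 0) (hκ : 2 ≤ κ 0)
    (hφ : φ (col hn 2 (by omega) hν) = col hm 2 (by omega) hκ) :
    n = m ∧ ∀ j < n, ν j = κ j := by
  have hk : ∀ y, y.k = 1 ↔ (φ y).k = 1 := by
    intro y
    rw [← h.not_col_two_le_iff hn hν, ← h'.not_col_two_le_iff hm hκ, ← hφ, φ.le_iff_le]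
  have hnm : n = m := by
    have := card_not_le_congr φ (col hn 2 (by omega) hν)
    rwa [hφ, h.card_not_le_col, h'.card_not_le_col, h.sum_min_one, h'.sum_min_one] at this
  subst hnm
  refine ⟨rfl, h.eq_of_gaps h' ?_ (h.sum_eq h' φ)⟩
  have hrow : (fun j : Fin n => φ (h.row j j.2)) = fun j : Fin n => h'.row j j.2 := by
    refine (StrictMono.range_inj (φ.strictMono.comp h.row_strictMono) h'.row_strictMono).1 ?_
    rw [Set.range_comp, h.range_row, h'.range_row]
    ext y
    obtain ⟨x, rfl⟩ := φ.surjective y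
    simp [hk]
  have hcount : ∀ j < n, ∑ l ∈ range n, (ν l - ν j) = ∑ l ∈ range n, (κ l - κ j) := by
    intro j hj
    have := card_not_le_congr φ (h.row j hj)
    rwa [congrFun hrow ⟨j, hj⟩, h.card_not_le_row, h'.card_not_le_row] at this
  intro j hj
  have h1 := hcount (j + 1) hj
  rw [h.sum_tsub_succ (by omega), h'.sum_tsub_succ (by omega), hcount j (by omega)] at h1
  exact Nat.eq_of_mul_eq_mul_left (Nat.succ_pos j) (Nat.add_left_cancel h1)

theorem IsLevelSeq.apply_row_of_apply_col_two (h : IsLevelSeq n ν) (h' : IsLevelSeq m κ)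
    (φ : LevelPoint (ν '' Set.Iio n) ≃o LevelPoint (κ '' Set.Iio m)) (hn : 0 < n) (hm : 1 < m)
    (hν : 2 ≤ ν 0) (hφ : φ (col hn 2 (by omega) hν) = h'.row 1 hm) :
    n = κ 0 - κ 1 ∧ ∀ j, ∀ hj : j < n, ∀ hκ : j + 1 ≤ κ 0,
      φ (h.row j hj) = col (by omega) (j + 1) (by omega) hκ := by
  have hκ1 := h'.pos hm
  have hκ01 := h'.lt zero_lt_one hm.le
  have hk : ∀ y, y.k = 1 ↔ κ 1 ≤ (φ y).c := by
    intro y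
    rw [← h.not_col_two_le_iff hn hν, ← φ.le_iff_le, hφ, le_def]
    have := (φ y).one_le
    simp only [row]
    omega
  have hnκ : n = κ 0 - κ 1 := by
    have := card_not_le_congr φ (col hn 2 (by omega) hν)
    rw [hφ, h.card_not_le_col, h'.card_not_le_row, h.sum_min_one,
      h'.sum_tsub_succ (by omega), h'.sum_tsub_zero] at this
    simpa using this
  refine ⟨hnκ, ?_⟩
  have hrow : (fun j : Fin n => φ (h.row j j.2)) =
      fun j : Fin n => col (by omega : 0 < m) (j.1 + 1) (by omega) (by omega) := by
    have hcol : StrictMono fun j : Fin n => (col (by omega : 0 < m) (j.1 + 1) (by omega)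
        (by omega) : LevelPoint (κ '' Set.Iio m)) := by
      intro i j hij
      have hij' : i.1 < j.1 := hij
      rw [lt_iff_le_not_ge, le_def, le_def]
      simp only [col]
      omega
    refine (StrictMono.range_inj (φ.strictMono.comp h.row_strictMono) hcol).1 ?_
    rw [Set.range_comp, h.range_row]
    ext y
    obtain ⟨x, rfl⟩ := φ.surjective y
    simp only [Set.mem_image, Set.mem_ofPred_eq, hk, Set.mem_range]
    constructor
    · rintro ⟨x', hx', hxx'⟩
      rw [hxx'] at hx'
      obtain ⟨l, hl, hlx⟩ := (φ x).mem
      have hone := (φ x).one_le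
      have hl0 : l = 0 := by
        by_contra hl0
        have := h'.le (Nat.one_le_iff_ne_zero.2 hl0) (le_of_lt hl)
        omega
      subst hl0
      refine ⟨⟨(φ x).k - 1, by omega⟩, LevelPoint.ext ?_ ?_⟩ <;> simp only [col] <;> omega
    · rintro ⟨j, hj⟩
      refine ⟨x, ?_, rfl⟩
      rw [← hj]
      simp only [col]
      omega
  intro j hj hκ
  exact congrFun hrow ⟨j, hj⟩

theorem IsLevelSeq.sum_tsub_eq_sum_min (h : IsLevelSeq n ν) (h' : IsLevelSeq m κ)
    (φ : LevelPoint (ν '' Set.Iio n) ≃o LevelPoint (κ '' Set.Iio m)) (hn : 0 < n) (hm : 1 < m)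
    (hν : 2 ≤ ν 0) (hφ : φ (col hn 2 (by omega) hν) = h'.row 1 hm) :
    ∀ j < n, ∑ l ∈ range n, (ν l - ν j) = ∑ l ∈ range m, min (κ l) j := by
  intro j hj
  obtain ⟨hnκ, hrow⟩ := h.apply_row_of_apply_col_two h' φ hn hm hν hφ
  have := card_not_le_congr φ (h.row j hj)
  rwa [hrow j hj (by omega), h.card_not_le_row, h'.card_not_le_col] at this

/-- The gaps when an isomorphism exchanges the two elements above the least one. -/
theorem IsLevelSeq.swap_gaps (h : IsLevelSeq n ν) (h' : IsLevelSeq m κ) (hmn : m ≤ n)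
    (hm : 1 < m) (hnκ : n = κ 0 - κ 1) (hmν : m = ν 0 - ν 1)
    (h1 : ∀ j < n, ∑ l ∈ range n, (ν l - ν j) = ∑ l ∈ range m, min (κ l) j)
    (h2 : ∀ j < m, ∑ l ∈ range m, (κ l - κ j) = ∑ l ∈ range n, min (ν l) j) :
    (n = m ∧ ∀ j, j + 1 < n → ν j - ν (j + 1) = κ j - κ (j + 1)) ∨
      (n = 3 ∧ m = 2 ∧ ν 1 - ν 2 = 1) := by
  have g : ∀ {n m : ℕ} {ν κ : ℕ → ℕ}, IsLevelSeq n ν →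
      (∀ j < n, ∑ l ∈ range n, (ν l - ν j) = ∑ l ∈ range m, min (κ l) j) →
      ∀ j, j + 1 < n → n - 1 ≤ (j + 1) * (ν j - ν (j + 1)) ∧ (j + 1) * (ν j - ν (j + 1)) ≤ m := by
    intro n m ν κ h h1 j hj
    have key : ∀ j, j + 1 < n → (j + 1) * (ν j - ν (j + 1)) = #{l ∈ range m | j < κ l} := by
      intro j hj
      have h3 := h1 (j + 1) hj
      rw [h.sum_tsub_succ (by omega), sum_min_succ, h1 j (by omega)] at h3
      omega
    constructor
    · have hlast := key (n - 2) (by omega)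
      have hs := h.succ_lt (n - 2) (by omega)
      have hle : n - 2 + 1 ≤ (n - 2 + 1) * (ν (n - 2) - ν (n - 2 + 1)) :=
        Nat.le_mul_of_pos_right _ (by omega)
      rw [key j hj]
      have hsub : #{l ∈ range m | n - 2 < κ l} ≤ #{l ∈ range m | j < κ l} := by
        apply card_le_card
        intro l
        simp only [mem_filter]
        exact fun hl => ⟨hl.1, by omega⟩
      omega
    · rw [key j hj]
      exact (card_filter_le _ _).trans_eq (card_range m)
  have gν := g h h1
  have gκ := g h' h2
  have hlast := gν (n - 2) (by omega)
  rcases Nat.lt_or_ge m n with hlt | hge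
  · right
    have hmn' : m = n - 1 := by omega
    obtain hn3 | hn4 : n = 3 ∨ 4 ≤ n := by omega
    · subst hn3
      have := gν 1 (by omega)
      norm_num at this
      refine ⟨rfl, by omega, by omega⟩
    · exfalso
      have h3 := gν (n - 3) (by omega)
      obtain ⟨q, rfl⟩ : ∃ q, n = q + 4 := ⟨n - 4, by omega⟩
      have e : q + 4 - 3 + 1 = q + 2 := by omega
      rw [e] at h3
      obtain hd | hd : ν (q + 4 - 3) - ν (q + 2) ≤ 1 ∨ 2 ≤ ν (q + 4 - 3) - ν (q + 2) := by omega
      · have := Nat.mul_le_mul_left (q + 2) hd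
        omega
      · have := Nat.mul_le_mul_left (q + 2) hd
        omega
  · left
    obtain rfl : n = m := by omega
    refine ⟨rfl, fun j hj => ?_⟩
    obtain rfl | hj0 := Nat.eq_zero_or_pos j
    · rw [zero_add]
      omega
    · have a1 := gν j hj
      have a2 := gκ j hj
      rcases lt_trichotomy (ν j - ν (j + 1)) (κ j - κ (j + 1)) with hlt | heq | hlt
      · have := Nat.mul_le_mul_left (j + 1) hlt
        rw [Nat.mul_succ] at this
        omega
      · exact heq
      · have := Nat.mul_le_mul_left (j + 1) hlt
        rw [Nat.mul_succ] at this
        omega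

theorem IsLevelSeq.swap_exceptional (h : IsLevelSeq 3 ν) (h' : IsLevelSeq 2 κ)
    (φ : LevelPoint (ν '' Set.Iio 3) ≃o LevelPoint (κ '' Set.Iio 2))
    (hν01 : ν 0 = ν 1 + 2) (hν12 : ν 1 = ν 2 + 1) (hκ01 : κ 0 = κ 1 + 3)
    (hcol : φ (col (by omega) 2 (by omega) (by omega)) = h'.row 1 (by omega))
    (hrow : ∀ j, ∀ hj : j < 3, φ (h.row j hj) = col (by omega) (j + 1) (by omega) (by omega)) :
    ν 2 = 1 ∧ κ 1 = 2 := by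
  have hν2 := h.pos (j := 2) (by omega)
  have hκ1 := h'.pos (j := 1) (by omega)
  have hsum := h.sum_eq h' φ
  simp only [sum_range_succ, sum_range_zero] at hsum
  by_contra hne
  have ha : 2 ≤ ν 2 := by omega
  set x : LevelPoint (ν '' Set.Iio 3) := col (by omega) 3 (by omega) (by omega) with hx
  have b1 : h'.row 1 (by omega) ≤ φ x := by
    rw [← hcol, φ.le_iff_le, le_def]
    simp only [hx, col]
    omega
  have b2 : col (by omega) 2 (by omega) (by omega) ≤ φ x := by
    rw [← hrow 1 (by omega), φ.le_iff_le, le_def]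
    simp only [hx, col, row]
    omega
  have b3 : ¬ col (by omega) 3 (by omega) (by omega) ≤ φ x := by
    rw [← hrow 2 (by omega), φ.le_iff_le, le_def]
    simp only [hx, col, row]
    omega
  rw [le_def] at b1 b2 b3
  simp only [col, row] at b1 b2 b3
  have hN := card_not_le_congr φ x
  rw [h.card_not_le, h'.card_not_le] at hN
  obtain ⟨l, hl, hlx⟩ := (φ x).mem
  have hl2 : l < 2 := hl
  have hxc : x.c = ν 0 - 3 := rfl
  have hxk : x.k = 3 := rfl
  simp only [sum_range_succ, sum_range_zero, hxc, hxk] at hN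
  generalize (φ x).c = c at *
  generalize (φ x).k = k at *
  clear hcol hrow
  clear_value x
  obtain rfl : k = 2 := by clear hN; omega
  obtain rfl : l = 1 := by
    by_contra hl1
    obtain rfl : l = 0 := by clear hN; omega
    clear hN
    omega
  obtain rfl : c = κ 1 - 2 := by clear hN; omega
  have e0 : ν 0 - 3 = ν 2 := by clear hN; omega
  have e1 : κ 0 - (κ 1 - 2) - 1 = 4 := by clear hN; omega
  have e2 : κ 1 - (κ 1 - 2) - 1 = 1 := by clear hN; omega
  rw [e0, e1, e2] at hN
  omega

theorem IsLevelSeq.swap_classification (h : IsLevelSeq n ν) (h' : IsLevelSeq m κ)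
    (φ : LevelPoint (ν '' Set.Iio n) ≃o LevelPoint (κ '' Set.Iio m)) (hmn : m ≤ n) (hm : 1 < m)
    (hν : 2 ≤ ν 0) (hκ : 2 ≤ κ 0)
    (hcol : φ (col (by omega) 2 (by omega) hν) = h'.row 1 hm)
    (hrow : φ (h.row 1 (by omega)) = col (by omega) 2 (by omega) hκ) :
    (n = m ∧ ∀ j < n, ν j = κ j) ∨
      (n = 3 ∧ m = 2 ∧ ν 0 = 4 ∧ ν 1 = 2 ∧ ν 2 = 1 ∧ κ 0 = 5 ∧ κ 1 = 2) := by
  have hcol' : φ.symm (col (by omega) 2 (by omega) hκ) = h.row 1 (by omega) := by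
    rw [← hrow, φ.symm_apply_apply]
  obtain ⟨hnκ, hrows⟩ := h.apply_row_of_apply_col_two h' φ _ hm hν hcol
  obtain ⟨hmν, -⟩ := h'.apply_row_of_apply_col_two h φ.symm _ (by omega) hκ hcol'
  rcases h.swap_gaps h' hmn hm hnκ hmν (h.sum_tsub_eq_sum_min h' φ _ hm hν hcol)
    (h'.sum_tsub_eq_sum_min h φ.symm _ (by omega) hκ hcol') with ⟨rfl, hg⟩ | ⟨rfl, rfl, hd⟩
  · exact Or.inl ⟨rfl, h.eq_of_gaps h' hg (h.sum_eq h' φ)⟩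
  · have := h.swap_exceptional h' φ (by omega) (by omega) (by omega) hcol
      (fun j hj => hrows j hj (by omega))
    omega

theorem IsLevelSeq.swap_of_consecutive (h : IsLevelSeq n ν) (h' : IsLevelSeq m κ)
    (φ : LevelPoint (ν '' Set.Iio n) ≃o LevelPoint (κ '' Set.Iio m)) (hmn : m ≤ n) (hm : 2 < m)
    (hν : ν 0 = ν 1 + 1) (hκ : κ 0 = κ 1 + 1) (hν2 : 2 ≤ ν 0) (hκ2 : 2 ≤ κ 0)
    (hcol : φ (col (by omega) 2 (by omega) hν2) = h'.row 2 hm)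
    (hrow : φ (h.row 2 (by omega)) = col (by omega) 2 (by omega) hκ2) :
    n = m ∧ ∀ j < n, ν j = κ j := by
  have two : ∀ {n : ℕ} {ν : ℕ → ℕ}, IsLevelSeq n ν → 2 < n → ν 0 = ν 1 + 1 →
      ∑ l ∈ range n, (ν l - ν 2) = 1 + 2 * (ν 1 - ν 2) := by
    intro n ν h hn hν
    rw [h.sum_tsub_succ (by omega), h.sum_tsub_succ (by omega), h.sum_tsub_zero]
    simp [hν]
  have hn' : n = 1 + 2 * (κ 1 - κ 2) := by
    have := card_not_le_congr φ (col (by omega) 2 (by omega) hν2)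
    rwa [hcol, h.card_not_le_col, h'.card_not_le_row, h.sum_min_one, two h' hm hκ] at this
  have hm' : m = 1 + 2 * (ν 1 - ν 2) := by
    have := card_not_le_congr φ (h.row 2 (by omega))
    rw [hrow, h.card_not_le_row, h'.card_not_le_col, h'.sum_min_one, two h (by omega) hν] at this
    exact this.symm
  obtain hn3 | hn4 : n = 3 ∨ 4 ≤ n := by omega
  · obtain rfl : n = m := by omega
    subst hn3
    refine ⟨rfl, h.eq_of_gaps h' (fun j hj => ?_) (h.sum_eq h' φ)⟩
    obtain rfl | rfl : j = 0 ∨ j = 1 := by omega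
    · simp only [zero_add]; omega
    · simp only [one_add_one_eq_two]; omega
  · exfalso
    have hκ3 := h'.pos hm
    let w : LevelPoint (κ '' Set.Iio m) :=
      ⟨κ 1 - 2, 2, by omega, 1, (by omega : 1 < m), by omega⟩
    have hlt : h.row 2 (by omega) < h.row 3 hn4 :=
      h.row_strictMono (a := ⟨2, by omega⟩) (b := ⟨3, hn4⟩) (Fin.mk_lt_mk.2 (by omega))
    have hlt' := φ.lt_iff_lt.2 hlt
    rw [hrow, lt_iff_le_not_ge, le_def, le_def] at hlt'
    simp only [col] at hlt'
    have hw : φ (h.row 3 hn4) = w := by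
      have hle : w ≤ φ (h.row 3 hn4) := by
        obtain ⟨l, hl, hlx⟩ := (φ (h.row 3 hn4)).mem
        have hl0 : l ≠ 0 → κ l ≤ κ 1 := fun h0 =>
          h'.le (Nat.one_le_iff_ne_zero.2 h0) (le_of_lt hl)
        rw [le_def]
        simp only [w]
        obtain rfl | h0 := Nat.eq_zero_or_pos l
        · omega
        · have := hl0 h0.ne'
          omega
      have hx1 : φ.symm w ≤ h.row 3 hn4 := (φ.symm_apply_le).2 hle
      have hx2 : h.row 2 (by omega) < φ.symm w := by
        rw [← φ.lt_iff_lt, φ.apply_symm_apply, hrow, lt_iff_le_not_ge, le_def, le_def]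
        simp only [col, w]
        omega
      obtain ⟨l, hl, hlx⟩ := h.exists_eq_row (x := φ.symm w) (by
        have := (φ.symm w).one_le
        have := (le_def.1 hx1).2
        simp only [row] at this
        omega)
      rw [hlx] at hx1 hx2
      have hx1' := (h.row_strictMono.le_iff_le (a := ⟨l, hl⟩) (b := ⟨3, hn4⟩)).1 hx1
      have hx2' := (h.row_strictMono.lt_iff_lt (a := ⟨2, by omega⟩) (b := ⟨l, hl⟩)).1 hx2
      rw [Fin.mk_le_mk] at hx1'
      rw [Fin.mk_lt_mk] at hx2'
      obtain rfl : l = 3 := by omega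
      rw [← hlx, φ.apply_symm_apply]
    have hN := card_not_le_congr φ (h.row 3 hn4)
    rw [hw, h.card_not_le_row, h'.card_not_le, h.sum_tsub_succ (by omega), two h (by omega) hν]
      at hN
    have hsum : ∑ l ∈ range m, min (κ l) (max (κ l - w.c - 1) (w.k - 1)) = m + 1 := by
      obtain ⟨q, rfl⟩ : ∃ q, m = q + 1 := ⟨m - 1, by omega⟩
      rw [sum_range_succ']
      have : ∀ l ∈ range q, min (κ (l + 1)) (max (κ (l + 1) - w.c - 1) (w.k - 1)) = 1 := by
        intro l hl
        rw [mem_range] at hl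
        have := h'.le (i := 1) (j := l + 1) (by omega) (by omega)
        have := h'.pos (j := l + 1) (by omega)
        simp only [w]
        omega
      rw [sum_congr rfl this, sum_const, card_range, smul_eq_mul, mul_one]
      simp only [w]
      omega
    rw [hsum] at hN
    have := h.succ_lt 2 (by omega)
    omega

theorem IsLevelSeq.row_zero_le (h : IsLevelSeq n ν) (hn : 0 < n)
    (x : LevelPoint (ν '' Set.Iio n)) : h.row 0 hn ≤ x := by
  have := h.c_add_k_le x
  have := x.one_le
  rw [le_def]
  simp only [row]
  omega

theorem IsLevelSeq.ne_row (h : IsLevelSeq n ν) {j : ℕ} (hj : j < n)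
    (x : LevelPoint (ν '' Set.Iio n)) : x ≠ h.row j hj ↔ 2 ≤ x.k ∨ x.c ≠ ν j - 1 := by
  have := x.one_le
  rw [Ne, LevelPoint.ext_iff]
  simp only [row]
  omega

theorem IsLevelSeq.col_ne_row (h : IsLevelSeq n ν) (hn : 0 < n) (hν : 2 ≤ ν 0) {j : ℕ}
    (hj : j < n) : col hn 2 (by omega) hν ≠ h.row j hj :=
  (h.ne_row hj _).2 (Or.inl le_rfl)

theorem IsLevelSeq.row_ne_row (h : IsLevelSeq n ν) {i j : ℕ} (hij : i < j) (hj : j < n) :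
    h.row j hj ≠ h.row i (hij.trans hj) :=
  (h.row_strictMono (a := ⟨i, hij.trans hj⟩) (b := ⟨j, hj⟩) hij).ne'

theorem IsLevelSeq.not_row_le_col (h : IsLevelSeq n ν) (hn : 0 < n) (hν : 2 ≤ ν 0) {j : ℕ}
    (hj : j < n) (hνj : ν j + 2 ≤ ν 0) : ¬ h.row j hj ≤ col hn 2 (by omega) hν := by
  have := h.pos hj
  rw [le_def]
  simp only [col, row]
  omega

theorem IsLevelSeq.not_col_le_row (h : IsLevelSeq n ν) (hn : 0 < n) (hν : 2 ≤ ν 0) {j : ℕ}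
    (hj : j < n) : ¬ col hn 2 (by omega) hν ≤ h.row j hj := by
  rw [h.not_col_two_le_iff]
  rfl

/-- Above the least element there are at most two minimal ones. -/
theorem IsLevelSeq.col_le_or_row_one_le (h : IsLevelSeq n ν) (hn : 1 < n) (hν : 2 ≤ ν 0)
    (x : LevelPoint (ν '' Set.Iio n)) (hx : x ≠ h.row 0 (by omega)) :
    col (by omega) 2 (by omega) hν ≤ x ∨ h.row 1 hn ≤ x := by
  rw [h.ne_row] at hx
  have h1 := x.one_le
  have h2 := h.c_add_k_le x
  obtain ⟨l, hl, hlx⟩ := x.mem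
  simp only [le_def, col, row]
  obtain rfl | hl0 := Nat.eq_zero_or_pos l
  · omega
  · have : ν l ≤ ν 1 := h.le hl0 (le_of_lt hl)
    omega

theorem IsLevelSeq.row_one_le (h : IsLevelSeq n ν) (hn : 1 < n) (hν : ν 0 = ν 1 + 1)
    (x : LevelPoint (ν '' Set.Iio n)) (hx : x ≠ h.row 0 (by omega)) : h.row 1 hn ≤ x := by
  have hν1 := h.pos hn
  refine (h.col_le_or_row_one_le hn (by omega) x hx).elim (fun hle => le_trans ?_ hle) id
  rw [le_def]
  simp only [col, row]
  omega

theorem IsLevelSeq.col_le_of_eq_one (h : IsLevelSeq 1 ν) (hν : 2 ≤ ν 0)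
    (x : LevelPoint (ν '' Set.Iio 1)) (hx : x ≠ h.row 0 one_pos) :
    col one_pos 2 (by omega) hν ≤ x := by
  by_contra hle
  rw [h.not_col_two_le_iff] at hle
  obtain ⟨l, hl, rfl⟩ := h.exists_eq_row hle
  obtain rfl : l = 0 := by omega
  exact hx rfl

theorem IsLevelSeq.col_le_of_eq_two (h : IsLevelSeq 2 ν) (hν : 2 ≤ ν 0)
    (x : LevelPoint (ν '' Set.Iio 2)) (hx : x ≠ h.row 0 two_pos ∧ x ≠ h.row 1 one_lt_two) :
    col two_pos 2 (by omega) hν ≤ x := by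
  by_contra hle
  rw [h.not_col_two_le_iff] at hle
  obtain ⟨l, hl, rfl⟩ := h.exists_eq_row hle
  obtain rfl | rfl : l = 0 ∨ l = 1 := by omega
  · exact hx.1 rfl
  · exact hx.2 rfl

theorem IsLevelSeq.col_le_or_row_two_le (h : IsLevelSeq n ν) (hn : 2 < n) (hν : 2 ≤ ν 0)
    (x : LevelPoint (ν '' Set.Iio n))
    (hx : x ≠ h.row 0 (by omega) ∧ x ≠ h.row 1 (by omega)) :
    col (by omega) 2 (by omega) hν ≤ x ∨ h.row 2 hn ≤ x := by
  by_contra! hle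
  obtain ⟨hle, hle'⟩ := hle
  rw [h.not_col_two_le_iff] at hle
  obtain ⟨l, hl, rfl⟩ := h.exists_eq_row hle
  have hl2 : ¬ 2 ≤ l := fun h2 =>
    hle' (h.row_strictMono.monotone (a := ⟨2, hn⟩) (b := ⟨l, hl⟩) h2)
  obtain rfl | rfl : l = 0 ∨ l = 1 := by omega
  · exact hx.1 rfl
  · exact hx.2 rfl

theorem IsLevelSeq.apply_row_zero (h : IsLevelSeq n ν) (h' : IsLevelSeq m κ)
    (φ : LevelPoint (ν '' Set.Iio n) ≃o LevelPoint (κ '' Set.Iio m)) (hn : 0 < n) (hm : 0 < m) :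
    φ (h.row 0 hn) = h'.row 0 hm :=
  ((φ.le_symm_apply).1 (h.row_zero_le hn _)).antisymm (h'.row_zero_le hm _)

/-- The classification when the two elements above the least one are incomparable. -/
theorem IsLevelSeq.classification_of_two_le (h : IsLevelSeq n ν) (h' : IsLevelSeq m κ)
    (φ : LevelPoint (ν '' Set.Iio n) ≃o LevelPoint (κ '' Set.Iio m)) (hmn : m ≤ n) (hn : 1 < n)
    (hm : 0 < m) (hν : ν 1 + 2 ≤ ν 0) (hκ : 2 ≤ κ 0) :
    (n = m ∧ ∀ j < n, ν j = κ j) ∨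
      (n = 3 ∧ m = 2 ∧ ν 0 = 4 ∧ ν 1 = 2 ∧ ν 2 = 1 ∧ κ 0 = 5 ∧ κ 1 = 2) := by
  have hn0 : 0 < n := by omega
  have hν0 : 2 ≤ ν 0 := by omega
  have hU : ∀ x, x ≠ h.row 0 hn0 ↔ φ x ≠ h'.row 0 hm := fun x => by
    rw [← h.apply_row_zero h' φ hn0 hm, φ.injective.ne_iff]
  have not_least : ∀ z, z ≠ h'.row 0 hm → (∀ y, y ≠ h'.row 0 hm → z ≤ y) → False :=
    fun z => φ.not_least_of_two_minimal (U := (· ≠ h.row 0 hn0)) (U' := (· ≠ h'.row 0 hm)) hU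
      (h.col_ne_row hn0 hν0 hn0) (h.row_ne_row one_pos hn)
      (h.not_col_le_row hn0 hν0 hn) (h.not_row_le_col hn0 hν0 hn hν)
      (h.col_le_or_row_one_le hn hν0)
  obtain rfl | hm1 : m = 1 ∨ 1 < m := by omega
  · exact (not_least _ (h'.col_ne_row hm hκ hm) (h'.col_le_of_eq_one hκ)).elim
  have hκ01 := h'.succ_lt 0 hm
  rw [zero_add] at hκ01
  obtain hκ1 | hκ1 : κ 0 = κ 1 + 1 ∨ κ 1 + 2 ≤ κ 0 := by omega
  · exact (not_least _ (h'.row_ne_row one_pos hm1) (h'.row_one_le hm1 hκ1)).elim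
  rcases φ.apply_eq_of_two_minimal (U := (· ≠ h.row 0 hn0)) (U' := (· ≠ h'.row 0 hm)) hU
      (h.col_ne_row hn0 hν0 hn0) (h.row_ne_row one_pos hn)
      (h.not_col_le_row hn0 hν0 hn) (h.not_row_le_col hn0 hν0 hn hν)
      (h.col_le_or_row_one_le hn hν0) (h'.col_ne_row hm hκ hm) (h'.row_ne_row one_pos hm1)
      (h'.col_le_or_row_one_le hm1 hκ) with ⟨hcol, -⟩ | ⟨hcol, hrow⟩
  · exact Or.inl (h.eq_of_apply_col_two h' φ hn0 hm hν0 hκ hcol)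
  · exact h.swap_classification h' φ hmn hm1 hν0 hκ hcol hrow

/-- The classification when the first gap of each sequence equals one. -/
theorem IsLevelSeq.classification_of_consecutive (h : IsLevelSeq n ν) (h' : IsLevelSeq m κ)
    (φ : LevelPoint (ν '' Set.Iio n) ≃o LevelPoint (κ '' Set.Iio m)) (hmn : m ≤ n) (hm : 1 < m)
    (hν : ν 0 = ν 1 + 1) (hκ : κ 0 = κ 1 + 1) : n = m ∧ ∀ j < n, ν j = κ j := by
  have hn1 : 1 < n := by omega
  have hn0 : 0 < n := by omega
  have hm0 : 0 < m := by omega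
  have hν1 := h.pos hn1
  have hκ1 := h'.pos hm
  have hν0 : 2 ≤ ν 0 := by omega
  have hκ0 : 2 ≤ κ 0 := by omega
  have hsum := h.sum_eq h' φ
  obtain rfl | hn2 : n = 2 ∨ 2 < n := by omega
  · obtain rfl : m = 2 := by omega
    simp only [sum_range_succ, sum_range_zero] at hsum
    refine ⟨rfl, fun j hj => ?_⟩
    obtain rfl | rfl : j = 0 ∨ j = 1 := by omega
    · omega
    · omega
  have hU0 : ∀ x, x ≠ h.row 0 hn0 ↔ φ x ≠ h'.row 0 hm0 := fun x => by
    rw [← h.apply_row_zero h' φ hn0 hm0, φ.injective.ne_iff]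
  have hφ1 : φ (h.row 1 hn1) = h'.row 1 hm := by
    refine le_antisymm ?_ (h'.row_one_le hm hκ _ ((hU0 _).1 (h.row_ne_row one_pos hn1)))
    refine (φ.le_symm_apply).1 (h.row_one_le hn1 hν _ ((hU0 _).2 ?_))
    rw [φ.apply_symm_apply]
    exact h'.row_ne_row one_pos hm
  have hU : ∀ x, (x ≠ h.row 0 hn0 ∧ x ≠ h.row 1 hn1) ↔
      (φ x ≠ h'.row 0 hm0 ∧ φ x ≠ h'.row 1 hm) := fun x => by
    rw [hU0, ← hφ1, φ.injective.ne_iff]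
  have hν2 : ν 2 + 2 ≤ ν 0 := by
    have : ν 2 < ν 1 := h.succ_lt 1 hn1
    omega
  have hacol : col hn0 2 (by omega) hν0 ≠ h.row 0 hn0 ∧ col hn0 2 (by omega) hν0 ≠ h.row 1 hn1 :=
    ⟨h.col_ne_row hn0 hν0 hn0, h.col_ne_row hn0 hν0 hn1⟩
  have harow : h.row 2 hn2 ≠ h.row 0 hn0 ∧ h.row 2 hn2 ≠ h.row 1 hn1 :=
    ⟨h.row_ne_row two_pos hn2, h.row_ne_row one_lt_two hn2⟩
  obtain rfl | hm2 : m = 2 ∨ 2 < m := by omega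
  · exact (φ.not_least_of_two_minimal hU hacol harow (h.not_col_le_row hn0 hν0 hn2)
      (h.not_row_le_col hn0 hν0 hn2 hν2) (h.col_le_or_row_two_le hn2 hν0)
      ⟨h'.col_ne_row hm0 hκ0 hm0, h'.col_ne_row hm0 hκ0 hm⟩ (h'.col_le_of_eq_two hκ0)).elim
  rcases φ.apply_eq_of_two_minimal hU hacol harow (h.not_col_le_row hn0 hν0 hn2)
      (h.not_row_le_col hn0 hν0 hn2 hν2) (h.col_le_or_row_two_le hn2 hν0)
      ⟨h'.col_ne_row hm0 hκ0 hm0, h'.col_ne_row hm0 hκ0 hm⟩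
      ⟨h'.row_ne_row two_pos hm2, h'.row_ne_row one_lt_two hm2⟩
      (h'.col_le_or_row_two_le hm2 hκ0) with ⟨hcol, -⟩ | ⟨hcol, hrow⟩
  · exact h.eq_of_apply_col_two h' φ hn0 hm0 hν0 hκ0 hcol
  · exact h.swap_of_consecutive h' φ hmn hm2 hν hκ hν0 hκ0 hcol hrow

theorem IsLevelSeq.classification (h : IsLevelSeq n ν) (h' : IsLevelSeq m κ)
    (φ : LevelPoint (ν '' Set.Iio n) ≃o LevelPoint (κ '' Set.Iio m)) (hmn : m ≤ n) :
    (n = m ∧ ∀ j < n, ν j = κ j) ∨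
      (n = 2 ∧ m = 1 ∧ ν 0 = ν 1 + 1 ∧ κ 0 = 2 * ν 1 + 1) ∨
      (n = 3 ∧ m = 2 ∧ ν 0 = 4 ∧ ν 1 = 2 ∧ ν 2 = 1 ∧ κ 0 = 5 ∧ κ 1 = 2) := by
  have hsum := h.sum_eq h' φ
  obtain rfl | hn := Nat.eq_zero_or_pos n
  · exact Or.inl ⟨by omega, fun j hj => absurd hj (Nat.not_lt_zero j)⟩
  have hν0 := h.pos hn
  have hle := single_le_sum (f := ν) (fun _ _ => Nat.zero_le _) (mem_range.2 hn)
  have hm : 0 < m := by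
    by_contra hm0
    obtain rfl : m = 0 := by omega
    rw [sum_range_zero] at hsum
    omega
  obtain rfl | hn1 : n = 1 ∨ 1 < n := by omega
  · obtain rfl : m = 1 := by omega
    rw [sum_range_one, sum_range_one] at hsum
    refine Or.inl ⟨rfl, fun j hj => ?_⟩
    obtain rfl : j = 0 := by omega
    exact hsum
  have hν1 := h.pos hn1
  have hν01 := h.succ_lt 0 hn
  rw [zero_add] at hν01
  have hν0' : 2 ≤ ν 0 := by omega
  have hκ0 : 2 ≤ κ 0 := by
    obtain rfl | hm1 : m = 1 ∨ 1 < m := by omega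
    · rw [sum_range_one] at hsum
      omega
    · have := h'.pos hm1
      have := h'.lt zero_lt_one hm1.le
      omega
  obtain hν2 | hν2 : ν 1 + 2 ≤ ν 0 ∨ ν 0 = ν 1 + 1 := by omega
  · exact (h.classification_of_two_le h' φ hmn hn1 hm hν2 hκ0).imp_right Or.inr
  obtain rfl | hm1 : m = 1 ∨ 1 < m := by omega
  · obtain rfl | hn2 : n = 2 ∨ 2 < n := by omega
    · simp only [sum_range_succ, sum_range_zero] at hsum
      omega
    · exfalso
      have hν2' : ν 2 < ν 1 := h.succ_lt 1 hn1
      have htotal : ∀ x y : LevelPoint (κ '' Set.Iio 1), x ≤ y ∨ y ≤ x := by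
        have hlevel : ∀ x : LevelPoint (κ '' Set.Iio 1), x.c + x.k = κ 0 := by
          intro x
          obtain ⟨l, hl, hlx⟩ := x.mem
          obtain rfl : l = 0 := Nat.lt_one_iff.1 hl
          exact hlx.symm
        intro x y
        have := hlevel x
        have := hlevel y
        rw [le_def, le_def]
        omega
      rcases htotal (φ (col hn 2 (by omega) hν0')) (φ (h.row 2 hn2)) with hc | hc
      · exact h.not_col_le_row hn hν0' hn2 (φ.le_iff_le.1 hc)
      · exact h.not_row_le_col hn hν0' hn2 (by omega) (φ.le_iff_le.1 hc)
  obtain hκ1 | hκ1 : κ 0 = κ 1 + 1 ∨ κ 1 + 2 ≤ κ 0 := by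
    have : κ 1 < κ 0 := h'.succ_lt 0 hm
    omega
  · exact Or.inl (h.classification_of_consecutive h' φ hmn hm1 hν2 hκ1)
  · have hU : ∀ y, y ≠ h'.row 0 hm ↔ φ.symm y ≠ h.row 0 hn := fun y => by
      rw [← h'.apply_row_zero h φ.symm hm hn, φ.symm.injective.ne_iff]
    exact (φ.symm.not_least_of_two_minimal (U := (· ≠ h'.row 0 hm)) (U' := (· ≠ h.row 0 hn)) hU
      (h'.col_ne_row hm hκ0 hm)
      (h'.row_ne_row one_pos hm1) (h'.not_col_le_row hm hκ0 hm1)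
      (h'.not_row_le_col hm hκ0 hm1 hκ1) (h'.col_le_or_row_one_le hm1 hκ0)
      (h.row_ne_row one_pos hn1) (h.row_one_le hn1 hν2)).elim

end LevelSequences

theorem OrderIso.supIrred_apply {α β : Type*} [SemilatticeSup α] [SemilatticeSup β]
    (φ : α ≃o β) {a : α} (ha : SupIrred a) : SupIrred (φ a) := by
  refine ⟨fun hmin => ha.1 ((φ.isMin_apply).1 hmin), fun b c hbc => ?_⟩
  rw [← φ.symm_apply_eq, φ.symm.map_sup] at hbc
  exact (ha.2 hbc).imp φ.symm_apply_eq.1 φ.symm_apply_eq.1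

/-- Finite posets with isomorphic lattices of lower sets are isomorphic. -/
theorem OrderIso.nonempty_of_lowerSet {α β : Type*} [PartialOrder α] [PartialOrder β]
    [Finite α] [Finite β] (φ : LowerSet α ≃o LowerSet β) : Nonempty (α ≃o β) :=
  ⟨OrderIso.supIrredLowerSet.trans <| OrderIso.trans
    { toEquiv := φ.toEquiv.subtypeEquiv fun s =>
        ⟨φ.supIrred_apply, fun hs => by simpa using φ.symm.supIrred_apply hs⟩
      map_rel_iff' := φ.map_rel_iff } OrderIso.supIrredLowerSet.symm⟩

/-- The exponents in decreasing order, followed by zeros. -/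
def levelSeq {n : ℕ} (lam : Fin n → ℕ) (j : ℕ) : ℕ :=
  if h : j < n then lam (Fin.rev ⟨j, h⟩) else 0

theorem levelSeq_of_lt {n : ℕ} (lam : Fin n → ℕ) {j : ℕ} (h : j < n) :
    levelSeq lam j = lam (Fin.rev ⟨j, h⟩) := dif_pos h

theorem levelSeq_rev {n : ℕ} (lam : Fin n → ℕ) (i : Fin n) :
    levelSeq lam (Fin.rev i) = lam i := by
  rw [levelSeq_of_lt lam (Fin.rev i).2, Fin.eta, Fin.rev_rev]

theorem isLevelSeq_levelSeq {n : ℕ} {lam : Fin n → ℕ} (h0 : ∀ i, 0 < lam i)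
    (h : StrictMono lam) : IsLevelSeq n (levelSeq lam) where
  succ_lt j hj := by
    rw [levelSeq_of_lt lam hj]
    by_cases hj' : j + 1 < n
    · rw [levelSeq_of_lt lam hj']
      exact h (Fin.rev_lt_rev.2 (Fin.mk_lt_mk.2 j.lt_succ_self))
    · rw [levelSeq, dif_neg hj']
      exact h0 _
  eq_zero := dif_neg (lt_irrefl n)

theorem image_levelSeq {n : ℕ} (lam : Fin n → ℕ) :
    levelSeq lam '' Set.Iio n = Set.range lam := by
  ext s
  constructor
  · rintro ⟨j, hj, rfl⟩
    exact ⟨_, (levelSeq_of_lt lam hj).symm⟩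
  · rintro ⟨i, rfl⟩
    exact ⟨Fin.rev i, (Fin.rev i).2, levelSeq_rev lam i⟩

theorem LevelPoint.exists_orderIso_consecutive (k : ℕ) :
    Nonempty (LevelPoint {k, k + 1} ≃o LevelPoint {2 * k + 1}) := by
  have hmem : ∀ x : LevelPoint {k, k + 1}, x.c + x.k = k ∨ x.c + x.k = k + 1 := fun x => x.mem
  have hmem' : ∀ x : LevelPoint {2 * k + 1}, x.c + x.k = 2 * k + 1 := fun x => x.mem
  let f : LevelPoint {k, k + 1} → LevelPoint {2 * k + 1} := fun x =>
    ⟨x.c + k + 1 - x.k, k + x.k - x.c, by have := hmem x; have := x.one_le; omega,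
      by have := hmem x; have := x.one_le; rw [Set.mem_singleton_iff]; omega⟩
  have hf : ∀ x y, f x ≤ f y ↔ x ≤ y := by
    intro x y
    have := hmem x
    have := hmem y
    have := x.one_le
    have := y.one_le
    simp only [f, le_def]
    omega
  refine ⟨RelIso.ofSurjective (OrderEmbedding.ofMapLEIff f hf) fun y => ?_⟩
  have := hmem' y
  have := y.one_le
  refine ⟨⟨y.c / 2, (y.k + 1) / 2, by omega, ?_⟩, LevelPoint.ext ?_ ?_⟩
  · rw [Set.mem_insert_iff, Set.mem_singleton_iff]
    omega
  · simp only [OrderEmbedding.coe_ofMapLEIff, f]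
    omega
  · simp only [OrderEmbedding.coe_ofMapLEIff, f]
    omega

theorem LevelPoint.exists_orderIso_exceptional :
    Nonempty (LevelPoint {1, 2, 4} ≃o LevelPoint {2, 5}) := by
  let F : ℕ × ℕ → ℕ × ℕ
    | (3, 1) => (4, 1)
    | (2, 2) => (1, 1)
    | (1, 3) => (0, 2)
    | (0, 4) => (0, 5)
    | (1, 1) => (3, 2)
    | (0, 2) => (1, 4)
    | _ => (2, 3)
  let L : Finset (ℕ × ℕ) := {(3, 1), (2, 2), (1, 3), (0, 4), (1, 1), (0, 2), (0, 1)}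
  let L' : Finset (ℕ × ℕ) := {(4, 1), (3, 2), (2, 3), (1, 4), (0, 5), (1, 1), (0, 2)}
  have hL : ∀ c k, (c, k) ∈ L ↔ 1 ≤ k ∧ c + k ∈ ({1, 2, 4} : Set ℕ) := by
    intro c k
    simp only [L, Finset.mem_insert, Finset.mem_singleton, Prod.mk.injEq, Set.mem_insert_iff,
      Set.mem_singleton_iff]
    omega
  have hL' : ∀ c k, (c, k) ∈ L' ↔ 1 ≤ k ∧ c + k ∈ ({2, 5} : Set ℕ) := by
    intro c k
    simp only [L', Finset.mem_insert, Finset.mem_singleton, Prod.mk.injEq, Set.mem_insert_iff,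
      Set.mem_singleton_iff]
    omega
  have hF : ∀ u ∈ L, F u ∈ L' := by decide
  have hFle : ∀ u ∈ L, ∀ v ∈ L,
      ((F v).1 ≤ (F u).1 ∧ (F u).2 ≤ (F v).2 ↔ v.1 ≤ u.1 ∧ u.2 ≤ v.2) := by decide
  have hFsurj : ∀ v ∈ L', ∃ u ∈ L, F u = v := by decide
  have hx : ∀ x : LevelPoint {1, 2, 4}, (x.c, x.k) ∈ L := fun x => (hL _ _).2 ⟨x.one_le, x.mem⟩
  let f : LevelPoint {1, 2, 4} → LevelPoint {2, 5} := fun x =>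
    ⟨(F (x.c, x.k)).1, (F (x.c, x.k)).2, ((hL' _ _).1 (hF _ (hx x))).1,
      ((hL' _ _).1 (hF _ (hx x))).2⟩
  refine ⟨RelIso.ofSurjective (OrderEmbedding.ofMapLEIff f fun x y => hFle _ (hx x) _ (hx y))
    fun y => ?_⟩
  obtain ⟨⟨c, k⟩, hu, huy⟩ := hFsurj _ ((hL' y.c y.k).2 ⟨y.one_le, y.mem⟩)
  exact ⟨⟨c, k, ((hL _ _).1 hu).1, ((hL _ _).1 hu).2⟩,
    LevelPoint.ext (congrArg Prod.fst huy) (congrArg Prod.snd huy)⟩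

theorem stmt_0 (p : ℕ) (hp : p.Prime) (hodd : p ≠ 2)
    (n m : ℕ) (lam : Fin n → ℕ) (mu : Fin m → ℕ)
    (hlam0 : ∀ i, 0 < lam i) (hlam : StrictMono lam)
    (hmu0 : ∀ j, 0 < mu j) (hmu : StrictMono mu)
    (hmn : m ≤ n) :
    Nonempty ({H : AddSubgroup (Π i : Fin n, ZMod (p ^ lam i)) // IsCharSub H} ≃o
      {K : AddSubgroup (Π j : Fin m, ZMod (p ^ mu j)) // IsCharSub K}) ↔
    ((∃ h : m = n, ∀ j : Fin m, mu j = lam (Fin.cast h j)) ∨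
     (∃ k : ℕ, 1 ≤ k ∧ n = 2 ∧ m = 1 ∧ (∀ i : Fin n, lam i = k + (i : ℕ)) ∧
        (∀ j : Fin m, mu j = 2 * k + 1)) ∨
     (n = 3 ∧ m = 2 ∧ (∀ i : Fin n, lam i = 2 ^ (i : ℕ)) ∧
        (∀ j : Fin m, mu j = 3 * (j : ℕ) + 2))) := by
  have of_levelPoint : ∀ {S T : Set ℕ}, Set.range lam = S → Set.range mu = T →
      Nonempty (LevelPoint S ≃o LevelPoint T) →
      Nonempty ({H : AddSubgroup (Π i : Fin n, ZMod (p ^ lam i)) // IsCharSub H} ≃o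
        {K : AddSubgroup (Π j : Fin m, ZMod (p ^ mu j)) // IsCharSub K}) := by
    rintro S T rfl rfl ⟨φ⟩
    exact ⟨((charSubOrderIso hp hodd hlam).trans (LowerSet.map φ)).trans
      (charSubOrderIso hp hodd hmu).symm⟩
  constructor
  · rintro ⟨Φ⟩
    obtain ⟨φ⟩ := OrderIso.nonempty_of_lowerSet
      (((charSubOrderIso hp hodd hlam).symm.trans Φ).trans (charSubOrderIso hp hodd hmu))
    rw [← image_levelSeq lam, ← image_levelSeq mu] at φ
    rcases (isLevelSeq_levelSeq hlam0 hlam).classification (isLevelSeq_levelSeq hmu0 hmu) φ hmn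
      with ⟨rfl, h⟩ | ⟨rfl, rfl, h, h'⟩ | ⟨rfl, rfl, h0, h1, h2, h0', h1'⟩
    · refine Or.inl ⟨rfl, fun j => ?_⟩
      rw [← levelSeq_rev mu, ← levelSeq_rev lam]
      exact (h _ (Fin.rev j).2).symm
    · refine Or.inr (Or.inl ⟨lam 0, hlam0 0, rfl, rfl, ?_, ?_⟩)
      · rw [Fin.forall_fin_two]
        exact ⟨rfl, h⟩
      · rw [Fin.forall_fin_one]
        exact h'
    · refine Or.inr (Or.inr ⟨rfl, rfl, ?_, ?_⟩)
      · intro i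
        fin_cases i
        exacts [h2, h1, h0]
      · rw [Fin.forall_fin_two]
        exact ⟨h1', h0'⟩
  · rintro (⟨rfl, h⟩ | ⟨k, -, rfl, rfl, hl, hm⟩ | ⟨rfl, rfl, hl, hm⟩)
    · obtain rfl : mu = lam := funext h
      exact ⟨OrderIso.refl _⟩
    · refine of_levelPoint ?_ ?_ (LevelPoint.exists_orderIso_consecutive k)
      · ext s
        simp [Fin.exists_fin_two, hl, eq_comm]
      · ext s
        simp [hm, eq_comm]
    · refine of_levelPoint ?_ ?_ LevelPoint.exists_orderIso_exceptional
      · ext s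
        simp [Fin.exists_fin_succ, hl, eq_comm]
      · ext s
        simp [Fin.exists_fin_two, hm, eq_comm]
end

section
/- Let g, h ∈ G be elements such that for every i ∈ {1,…,n} the i-th components g_i and h_i have the same (additive) order. Then g and h are automorphic, i.e., there exists an automorphism φ of G with φ(g) = h. -/
/-- In `ZMod N` with `N ≠ 0`, every element is a unit multiple of the divisor
`N / addOrderOf a` of `N`. -/
theorem ZMod.exists_units_smul_natCast_div_addOrderOf {N : ℕ} (hN : N ≠ 0) (a : ZMod N) :
    ∃ u : (ZMod N)ˣ, u • ((N / addOrderOf a : ℕ) : ZMod N) = a := by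
  obtain ⟨d, hd, _, ⟨u, rfl⟩, rfl⟩ := a.eq_unit_mul_divisor
  refine ⟨u, ?_⟩
  have horder : addOrderOf ((u : ZMod N) * d) = N / d :=
    calc addOrderOf ((u : ZMod N) * d)
        = addOrderOf (d : ZMod N) :=
          addOrderOf_injective (DistribSMul.toAddMonoidHom (ZMod N) u) (MulAction.injective u) _
      _ = N / d := by rw [ZMod.addOrderOf_coe d hN, Nat.gcd_eq_right hd]
  rw [horder, Nat.div_div_self hd hN, Units.smul_def, smul_eq_mul]

/-- Elements of `ZMod N` of the same additive order differ by a unit. -/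
theorem ZMod.exists_units_smul_eq_of_addOrderOf_eq {N : ℕ} (hN : N ≠ 0) {a b : ZMod N}
    (hab : addOrderOf a = addOrderOf b) : ∃ u : (ZMod N)ˣ, u • a = b := by
  obtain ⟨u, hu⟩ := ZMod.exists_units_smul_natCast_div_addOrderOf hN a
  obtain ⟨v, hv⟩ := ZMod.exists_units_smul_natCast_div_addOrderOf hN b
  refine ⟨v * u⁻¹, ?_⟩
  rw [mul_smul, inv_smul_eq_iff.mpr hu.symm, hab, hv]

theorem stmt_1 (p : ℕ) (hp : p.Prime) (n : ℕ) (hn : 0 < n)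
    (lam : Fin n → ℕ) (hlam1 : ∀ i, 1 ≤ lam i) (hlam : Monotone lam)
    (g h : Π i : Fin n, ZMod (p ^ lam i))
    (hgh : ∀ i, addOrderOf (g i) = addOrderOf (h i)) :
    ∃ φ : AddAut (Π i : Fin n, ZMod (p ^ lam i)), φ g = h := by
  choose u hu using fun i =>
    ZMod.exists_units_smul_eq_of_addOrderOf_eq (pow_ne_zero (lam i) hp.ne_zero) (hgh i)
  exact ⟨AddEquiv.piCongrRight fun i => DistribMulAction.toAddEquiv (ZMod (p ^ lam i)) (u i),
    funext hu⟩
end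

section
/- Let a = (a_1,…,a_n) be a tuple with 0 ≤ a_i ≤ λ_i for all i, and suppose a is noncanonical at coordinate i, meaning that either a_i < a_{i−1} (for some i with 2 ≤ i ≤ n) or a_{i+1} − a_i > λ_{i+1} − λ_i (for some i with 1 ≤ i ≤ n−1). Then every element of type T(a) is automorphic to some element of type T(a + e_i), where e_i denotes the tuple with 1 in coordinate i and 0 elsewhere. -/
/-- The elementary automorphism of a product of abelian groups adding `f (x j)` to the `i`-th
coordinate of `x`. -/
def AddEquiv.piTransvection {ι : Type*} [DecidableEq ι] {G : ι → Type*} [∀ k, AddCommGroup (G k)]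
    {i j : ι} (hij : j ≠ i) (f : G j →+ G i) : AddAut (Π k, G k) where
  toFun x := x + Pi.single i (f (x j))
  invFun x := x - Pi.single i (f (x j))
  left_inv x := by simp [Pi.single_eq_of_ne hij]
  right_inv x := by simp [Pi.single_eq_of_ne hij]
  map_add' x y := by
    simp only [Pi.add_apply, map_add, Pi.single_add]
    abel

theorem AddEquiv.piTransvection_apply {ι : Type*} [DecidableEq ι] {G : ι → Type*}
    [∀ k, AddCommGroup (G k)] {i j : ι} (hij : j ≠ i) (f : G j →+ G i) (x : Π k, G k) :
    AddEquiv.piTransvection hij f x = x + Pi.single i (f (x j)) :=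
  rfl

/-- Multiplication by `p ^ e` as a homomorphism `ZMod (p ^ l) →+ ZMod (p ^ m)`, applied to the
class of an integer. -/
theorem ZMod.exists_addMonoidHom_intCast_eq_pow_mul (p : ℕ) {l m e : ℕ} (h : m ≤ l + e) :
    ∃ f : ZMod (p ^ l) →+ ZMod (p ^ m), ∀ z : ℤ, f z = ((p ^ e * z : ℤ) : ZMod (p ^ m)) := by
  have h0 : zmultiplesHom (ZMod (p ^ m)) ((p : ZMod (p ^ m)) ^ e) ((p ^ l : ℕ) : ℤ) = 0 := by
    have : ((p ^ (l + e) : ℕ) : ZMod (p ^ m)) = 0 :=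
      (ZMod.natCast_eq_zero_iff _ _).2 (pow_dvd_pow p h)
    simpa [pow_add] using this
  refine ⟨ZMod.lift (p ^ l) ⟨_, h0⟩, fun z => ?_⟩
  rw [ZMod.lift_coe]
  simp [mul_comm]

/-- An element of order `p ^ b` can be mapped to one of order `p ^ (c + 1)`, provided that `c` is
small enough. -/
theorem ZMod.exists_addMonoidHom_pow_smul_ne_zero_and_eq_zero {p : ℕ} (hp : p.Prime)
    {l m b c : ℕ} (hcb : c < b) (hc : c + l < b + m) {x : ZMod (p ^ l)}
    (hx : addOrderOf x = p ^ b) :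
    ∃ f : ZMod (p ^ l) →+ ZMod (p ^ m), p ^ c • f x ≠ 0 ∧ p ^ (c + 1) • f x = 0 := by
  obtain ⟨e, he⟩ : ∃ e, c + 1 + e + l = b + m := ⟨b + m - (c + 1 + l), by omega⟩
  obtain ⟨z, rfl⟩ := ZMod.intCast_surjective x
  obtain ⟨f, hf⟩ := ZMod.exists_addMonoidHom_intCast_eq_pow_mul p (show m ≤ l + e by omega)
  have hp0 : (p : ℤ) ≠ 0 := mod_cast hp.ne_zero
  have smul_iff (r s : ℕ) (w : ℤ) : p ^ s • (w : ZMod (p ^ r)) = 0 ↔ (p : ℤ) ^ r ∣ p ^ s * w := by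
    rw [← Nat.cast_pow p r, ← ZMod.intCast_zmod_eq_zero_iff_dvd]
    simp
  have image_iff (s t : ℕ) (h : s + e + l = t + m) :
      p ^ s • f z = 0 ↔ p ^ t • (z : ZMod (p ^ l)) = 0 := by
    rw [hf, smul_iff, smul_iff, ← mul_dvd_mul_iff_left (pow_ne_zero l hp0),
      ← mul_dvd_mul_iff_left (b := (p : ℤ) ^ l) (pow_ne_zero m hp0),
      show (p : ℤ) ^ l * (p ^ s * (p ^ e * z)) = p ^ (s + e + l) * z by ring,
      show (p : ℤ) ^ m * (p ^ t * z) = p ^ (t + m) * z by ring, h, mul_comm ((p : ℤ) ^ l)]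
  refine ⟨f, ?_, (image_iff _ b he).2 (hx ▸ addOrderOf_nsmul_eq_zero _)⟩
  rw [Ne, image_iff c (b - 1) (by omega), ← addOrderOf_dvd_iff_nsmul_eq_zero, hx,
    Nat.pow_dvd_pow_iff_le_right hp.one_lt]
  omega

theorem stmt_2 (p : ℕ) (hp : p.Prime) (n : ℕ) (hn : 0 < n)
    (lam : Fin n → ℕ) (hlam1 : ∀ i, 1 ≤ lam i) (hlam : Monotone lam)
    (a : Fin n → ℕ) (ha : ∀ i, a i ≤ lam i) (i : Fin n)
    -- noncanonical at coordinate `i`: either `a i < a (i-1)`,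
    -- or `a (i+1) - a i > lam (i+1) - lam i` (written additively)
    (hnc : (∃ j : Fin n, (j : ℕ) + 1 = (i : ℕ) ∧ a i < a j) ∨
           (∃ j : Fin n, (i : ℕ) + 1 = (j : ℕ) ∧ a i + lam j < a j + lam i))
    (g : Π k : Fin n, ZMod (p ^ lam k))
    (hg : ∀ k, addOrderOf (g k) = p ^ a k) :
    ∃ φ : AddAut (Π k : Fin n, ZMod (p ^ lam k)),
      ∀ k, addOrderOf (φ g k) = p ^ (a k + if k = i then 1 else 0) := by
  obtain ⟨j, hji, hlt, hlt'⟩ : ∃ j, j ≠ i ∧ a i < a j ∧ a i + lam j < a j + lam i := by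
    obtain ⟨j, hj, h⟩ | ⟨j, hj, h⟩ := hnc
    · have := hlam (show j ≤ i from Fin.le_def.2 (by omega))
      exact ⟨j, Fin.ne_of_val_ne (by omega), by omega, by omega⟩
    · have := hlam (show i ≤ j from Fin.le_def.2 (by omega))
      exact ⟨j, Fin.ne_of_val_ne (by omega), by omega, by omega⟩
  obtain ⟨f, hf, hf'⟩ :=
    ZMod.exists_addMonoidHom_pow_smul_ne_zero_and_eq_zero hp hlt hlt' (hg j)
  refine ⟨AddEquiv.piTransvection hji f, fun k => ?_⟩
  rw [AddEquiv.piTransvection_apply]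
  obtain rfl | hk := eq_or_ne k i
  · have := Fact.mk hp
    have h0 : p ^ a k • g k = 0 := hg k ▸ addOrderOf_nsmul_eq_zero _
    simp only [Pi.add_apply, Pi.single_eq_same, if_true]
    apply addOrderOf_eq_prime_pow
    · rwa [smul_add, h0, zero_add]
    · rw [smul_add, hf', add_zero, pow_succ', mul_smul, h0, smul_zero]
  · simp [hk, hg k]
end

section
/- Suppose p is an odd prime. Then every characteristic subgroup H of G is regular, i.e., H = R(a) for some tuple a with 0 ≤ a_i ≤ λ_i for all i. -/
/-- The regular subgroup `R(a)`: elements whose `i`-th component is killed by `p ^ a i`. -/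
def regSub (p : ℕ) {n : ℕ} (lam a : Fin n → ℕ) :
    AddSubgroup (Π i : Fin n, ZMod (p ^ lam i)) where
  carrier := {g | ∀ i, (p ^ a i : ℕ) • g i = 0}
  zero_mem' := by intro i; simp
  add_mem' := by
    intro x y hx hy i
    have : (p ^ a i : ℕ) • (x i + y i) = 0 := by
      rw [smul_add, hx i, hy i, add_zero]
    simpa using this
  neg_mem' := by
    intro x hx i
    have : (p ^ a i : ℕ) • (-x i) = 0 := by
      rw [smul_neg, hx i, neg_zero]
    simpa using this

/-- Characteristic subgroups of a ring's additive group are stable under multiplication by units. -/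
theorem IsCharSub.units_mul_mem {R : Type*} [Ring R] {H : AddSubgroup R} (hH : IsCharSub H)
    (u : Rˣ) {x : R} (hx : x ∈ H) : (u : R) * x ∈ H := by
  rw [← hH (DistribMulAction.toAddAut Rˣ R u)]
  exact ⟨x, hx, rfl⟩

/-- If `2` is a unit in every factor, a characteristic subgroup of a product of rings contains
the components of each of its elements. -/
theorem IsCharSub.single_mem_s7 {ι : Type*} [DecidableEq ι] {R : ι → Type*} [∀ i, Ring (R i)]
    {H : AddSubgroup (Π i, R i)} (hH : IsCharSub H) (h2 : ∀ i, IsUnit (2 : R i))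
    {x : Π i, R i} (hx : x ∈ H) (i : ι) : Pi.single i (x i) ∈ H := by
  let u : (Π i, R i)ˣ := MulEquiv.piUnits.symm (Function.update 1 i (h2 i).unit)
  have hmem := H.sub_mem (hH.units_mul_mem u hx) hx
  convert hmem using 1
  ext j
  by_cases hj : j = i
  · subst hj
    simp [u, two_mul]
  · simp [u, hj]

/-- Every subgroup of a cyclic group of order `p ^ l` is the kernel of multiplication by some
`p ^ a` with `a ≤ l`. -/
theorem ZMod.exists_mem_iff_pow_nsmul_eq_zero {p : ℕ} (hp : p.Prime) (l : ℕ)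
    (K : AddSubgroup (ZMod (p ^ l))) :
    ∃ a ≤ l, ∀ x, x ∈ K ↔ (p ^ a : ℕ) • x = 0 := by
  classical
  have : NeZero p := ⟨hp.ne_zero⟩
  have hdvd : Nat.card K ∣ p ^ l := by
    simpa using K.card_addSubgroup_dvd_card
  obtain ⟨a, hal, ha⟩ := (Nat.dvd_prime_pow hp).1 hdvd
  refine ⟨a, hal, ?_⟩
  have hsub : (K : Set (ZMod (p ^ l))) ⊆ {x | (p ^ a : ℕ) • x = 0} := by
    intro x hx
    have h := card_nsmul_eq_zero' (x := (⟨x, hx⟩ : K))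
    rw [ha] at h
    exact congrArg Subtype.val h
  have hcard : ({x | (p ^ a : ℕ) • x = 0} : Set (ZMod (p ^ l))).ncard
      ≤ (K : Set (ZMod (p ^ l))).ncard := by
    have h := IsAddCyclic.card_nsmul_eq_zero_le (α := ZMod (p ^ l)) (pow_pos hp.pos a)
    rw [Set.ncard_eq_toFinset_card']
    change _ ≤ Nat.card K
    rw [ha]
    simpa using h
  have heq := Set.eq_of_subset_of_ncard_le hsub hcard (Set.toFinite _)
  exact fun x => Set.ext_iff.1 heq x

theorem stmt_7 (p : ℕ) (hp : p.Prime) (hodd : p ≠ 2) (n : ℕ) (hn : 0 < n)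
    (lam : Fin n → ℕ) (hlam1 : ∀ i, 1 ≤ lam i) (hlam : Monotone lam)
    (H : AddSubgroup (Π i : Fin n, ZMod (p ^ lam i))) (hH : IsCharSub H) :
    ∃ a : Fin n → ℕ, (∀ i, a i ≤ lam i) ∧ H = regSub p lam a := by
  have h2 : ∀ i, IsUnit (2 : ZMod (p ^ lam i)) := fun i => by
    have hcop : Nat.Coprime 2 (p ^ lam i) :=
      Nat.Coprime.pow_right _ ((Nat.coprime_primes Nat.prime_two hp).2 hodd.symm)
    exact_mod_cast (ZMod.isUnit_iff_coprime 2 (p ^ lam i)).2 hcop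
  choose a ha hmem using fun i => ZMod.exists_mem_iff_pow_nsmul_eq_zero hp (lam i)
    (H.comap (AddMonoidHom.single (fun i => ZMod (p ^ lam i)) i))
  refine ⟨a, ha, AddSubgroup.ext fun x => ⟨fun hx i => ?_, fun hx => ?_⟩⟩
  · exact (hmem i (x i)).1 (hH.single_mem_s7 h2 hx i)
  · rw [← Finset.univ_sum_single x]
    exact H.sum_mem fun i _ => (hmem i (x i)).2 (hx i)
end

section
/- Let G = Z_{2^{λ_1}} × ⋯ × Z_{2^{λ_n}} be an abelian 2-group and let m be a canonical tuple with r nondegenerate coordinates. Then the number of characteristic subgroups H of G satisfying m_i = max{ a_i : a is a tuple with T(a) ⊆ H } for every i (the characteristic subgroups below m) is equal to the number of subgroups K of (Z_2)^r such that π_i(K) = Z_2 for every coordinate projection π_i, i ∈ {1,…,r} (the projection-surjective subgroups of (Z_2)^r). -/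
/-- A tuple `a` is canonical (w.r.t. the exponents `lam`) if `a` is weakly increasing and
`a (i+1) - a i ≤ lam (i+1) - lam i` for adjacent coordinates (written additively). -/
def IsCanonical {n : ℕ} (lam a : Fin n → ℕ) : Prop :=
  ∀ i j : Fin n, (i : ℕ) + 1 = (j : ℕ) → a i ≤ a j ∧ a j + lam i ≤ a i + lam j

/-- A canonical tuple `a` is degenerate at coordinate `i` if `a i = a (i-1)`
(with the convention `a 0 = 0` before the first coordinate), or
`a (i+1) - a i = lam (i+1) - lam i` (written additively). -/
def DegenAt {n : ℕ} (lam a : Fin n → ℕ) (i : Fin n) : Prop :=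
  ((i : ℕ) = 0 ∧ a i = 0) ∨
  (∃ j : Fin n, (j : ℕ) + 1 = (i : ℕ) ∧ a i = a j) ∨
  (∃ j : Fin n, (i : ℕ) + 1 = (j : ℕ) ∧ a j + lam i = a i + lam j)

/-- The type `T(a)`: elements whose `i`-th component has additive order exactly `p ^ a i`. -/
def typeSet (p : ℕ) {n : ℕ} (lam : Fin n → ℕ) (a : Fin n → ℕ) :
    Set (Π i : Fin n, ZMod (p ^ lam i)) :=
  {g | ∀ i, addOrderOf (g i) = p ^ a i}

theorem ZMod.exists_eq_two_pow_nsmul {l a : ℕ} (ha : a ≤ l) {x : ZMod (2 ^ l)}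
    (hx : 2 ^ a • x = 0) : ∃ y, x = 2 ^ (l - a) • y := by
  have h : ((2 ^ a * x.val : ℕ) : ZMod (2 ^ l)) = 0 := by
    simpa [nsmul_eq_mul] using hx
  rw [ZMod.natCast_eq_zero_iff] at h
  have h' : 2 ^ a * 2 ^ (l - a) ∣ 2 ^ a * x.val := by rwa [← pow_add, Nat.add_sub_cancel' ha]
  obtain ⟨k, hk⟩ := Nat.dvd_of_mul_dvd_mul_left (by positivity) h'
  refine ⟨(k : ZMod (2 ^ l)), ?_⟩
  rw [← ZMod.natCast_zmod_val x, hk]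
  simp [nsmul_eq_mul]

theorem ZMod.two_pow_nsmul_eq_zero (l : ℕ) (x : ZMod (2 ^ l)) : 2 ^ l • x = 0 := by
  rw [nsmul_eq_mul, ZMod.natCast_self, zero_mul]

theorem ZMod.two_pow_nsmul_eq_zero_of_le {l a b : ℕ} (hab : a ≤ b) {x : ZMod (2 ^ l)}
    (hx : 2 ^ a • x = 0) : 2 ^ b • x = 0 := by
  rw [← Nat.sub_add_cancel hab, pow_add, mul_nsmul', hx, nsmul_zero]

/-- The additive order of an element of `ZMod (2 ^ l)` is a power of two. -/
theorem ZMod.exists_addOrderOf_eq_two_pow (l : ℕ) (x : ZMod (2 ^ l)) :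
    ∃ a ≤ l, addOrderOf x = 2 ^ a :=
  (Nat.dvd_prime_pow Nat.prime_two).1
    (addOrderOf_dvd_of_nsmul_eq_zero (ZMod.two_pow_nsmul_eq_zero l x))

/-- `ZMod (2 ^ l)` is uniserial: the elements killed by a power of two are multiples of
any element of at least that order. -/
theorem ZMod.exists_eq_nsmul {l a : ℕ} {x y : ZMod (2 ^ l)} (hx : 2 ^ a • x ≠ 0)
    (hy : 2 ^ (a + 1) • y = 0) : ∃ k : ℕ, y = k • x := by
  obtain ⟨c, hcl, hc⟩ := ZMod.exists_addOrderOf_eq_two_pow l x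
  have hac : a + 1 ≤ c := by
    by_contra! h
    exact hx (ZMod.two_pow_nsmul_eq_zero_of_le (Nat.lt_succ_iff.1 h)
      (hc ▸ addOrderOf_nsmul_eq_zero x))
  have hdvd : addOrderOf y ∣ addOrderOf x := by
    rw [hc]
    exact (addOrderOf_dvd_of_nsmul_eq_zero hy).trans (pow_dvd_pow 2 hac)
  have hcard := IsAddCyclic.card_nsmul_eq_zero_le (α := ZMod (2 ^ l)) (addOrderOf_pos x)
  have : Fintype.card (AddSubgroup.zmultiples x) = addOrderOf x := Fintype.card_zmultiples
  let S : Finset (ZMod (2 ^ l)) := Finset.univ.filter (· ∈ AddSubgroup.zmultiples x)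
  have hS : S ⊆ Finset.univ.filter (fun z => addOrderOf x • z = 0) := by
    intro z hz
    obtain ⟨k, rfl⟩ := AddSubgroup.mem_zmultiples_iff.1 (Finset.mem_filter.1 hz).2
    rw [Finset.mem_filter]
    exact ⟨Finset.mem_univ _, by rw [smul_comm, addOrderOf_nsmul_eq_zero, smul_zero]⟩
  have hSc : S.card = addOrderOf x := by
    rw [← this, Fintype.card_subtype]
  have heq := Finset.eq_of_subset_of_card_le hS (by rw [hSc]; exact hcard)
  have hyS : y ∈ S := by
    rw [heq]
    simpa using addOrderOf_dvd_iff_nsmul_eq_zero.1 hdvd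
  obtain ⟨k, hk⟩ := mem_multiples_iff_mem_zmultiples.2 (Finset.mem_filter.1 hyS).2
  exact ⟨k, hk.symm⟩

theorem ZMod.two_pow_nsmul_add_eq_zero {l a : ℕ} {x y : ZMod (2 ^ l)}
    (hx' : 2 ^ (a + 1) • x = 0) (hx : 2 ^ a • x ≠ 0)
    (hy' : 2 ^ (a + 1) • y = 0) (hy : 2 ^ a • y ≠ 0) : 2 ^ a • (x + y) = 0 := by
  obtain ⟨k, rfl⟩ := ZMod.exists_eq_nsmul hx hy'
  rcases Nat.even_or_odd' k with ⟨c, rfl | rfl⟩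
  · refine absurd ?_ hy
    rw [← mul_nsmul', show 2 ^ a * (2 * c) = c * 2 ^ (a + 1) by ring, mul_nsmul', hx', nsmul_zero]
  · rw [← succ_nsmul', ← mul_nsmul', show 2 ^ a * (2 * c + 1 + 1) = (c + 1) * 2 ^ (a + 1) by ring,
      mul_nsmul', hx', nsmul_zero]

theorem ZMod.exists_two_pow_nsmul_ne_zero {l a : ℕ} (ha : 0 < a) (hal : a ≤ l) :
    ∃ x : ZMod (2 ^ l), 2 ^ a • x = 0 ∧ 2 ^ (a - 1) • x ≠ 0 := by
  refine ⟨((2 ^ (l - a) : ℕ) : ZMod (2 ^ l)), ?_, ?_⟩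
  · rw [nsmul_eq_mul, ← Nat.cast_mul, ← pow_add, Nat.add_sub_cancel' hal, ZMod.natCast_self]
  · rw [nsmul_eq_mul, ← Nat.cast_mul, ← pow_add, Ne, ZMod.natCast_eq_zero_iff,
      Nat.pow_dvd_pow_iff_le_right (by norm_num)]
    omega

theorem IsCanonical.le_and_add_le {n : ℕ} {lam a : Fin n → ℕ} (h : IsCanonical lam a)
    {i j : Fin n} (hij : i ≤ j) : a i ≤ a j ∧ a j + lam i ≤ a i + lam j := by
  obtain ⟨i, hi⟩ := i
  obtain ⟨j, hj⟩ := j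
  replace hij : i ≤ j := hij
  induction j, hij using Nat.le_induction with
  | base => exact ⟨le_rfl, le_rfl⟩
  | succ k hik ih =>
    have h1 := ih (by omega)
    have h2 := h ⟨k, by omega⟩ ⟨k + 1, hj⟩ rfl
    omega

/-- The subgroup of elements whose `i`-th component has additive order dividing `2 ^ a i`. -/
def regularSubgroup {n : ℕ} (lam a : Fin n → ℕ) : AddSubgroup (Π i : Fin n, ZMod (2 ^ lam i)) where
  carrier := {g | ∀ i, 2 ^ a i • g i = 0}
  zero_mem' := by simp
  add_mem' := by
    intro x y hx hy i
    rw [Pi.add_apply, nsmul_add, hx i, hy i, add_zero]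
  neg_mem' := by
    intro x hx i
    rw [Pi.neg_apply, smul_neg, hx i, neg_zero]

theorem mem_regularSubgroup {n : ℕ} {lam a : Fin n → ℕ} {g : Π i : Fin n, ZMod (2 ^ lam i)} :
    g ∈ regularSubgroup lam a ↔ ∀ i, 2 ^ a i • g i = 0 := Iff.rfl

/-- The regular subgroup of a canonical tuple is fully invariant. -/
theorem IsCanonical.map_mem_regularSubgroup {n : ℕ} {lam a : Fin n → ℕ} (h : IsCanonical lam a)
    (ha : ∀ i, a i ≤ lam i)
    (φ : (Π i : Fin n, ZMod (2 ^ lam i)) →+ (Π i : Fin n, ZMod (2 ^ lam i)))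
    {g : Π i : Fin n, ZMod (2 ^ lam i)} (hg : g ∈ regularSubgroup lam a) :
    φ g ∈ regularSubgroup lam a := by
  rw [← Finset.univ_sum_single g, map_sum]
  refine sum_mem fun j _ i => ?_
  rcases le_total j i with hji | hij
  · rw [← Pi.smul_apply, ← map_nsmul, ← Pi.single_smul,
      ZMod.two_pow_nsmul_eq_zero_of_le (h.le_and_add_le hji).1 (hg j), Pi.single_zero, map_zero,
      Pi.zero_apply]
  · obtain ⟨y, hy⟩ := ZMod.exists_eq_two_pow_nsmul (ha j) (hg j)
    rw [hy, Pi.single_smul, map_nsmul, Pi.smul_apply, ← mul_nsmul', ← pow_add]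
    have h1 := (h.le_and_add_le hij).2
    have h2 := ha j
    exact ZMod.two_pow_nsmul_eq_zero_of_le (by omega) (ZMod.two_pow_nsmul_eq_zero _ _)

theorem IsCharSub.map_mem {G : Type*} [AddGroup G] {H : AddSubgroup G} (hH : IsCharSub H)
    (φ : AddAut G) {g : G} (hg : g ∈ H) : φ g ∈ H := by
  rw [← hH φ]
  exact AddSubgroup.mem_map_of_mem _ hg

theorem isCharSub_of_forall_map_mem {G : Type*} [AddGroup G] {H : AddSubgroup G}
    (hH : ∀ (φ : AddAut G), ∀ g ∈ H, φ g ∈ H) : IsCharSub H := by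
  intro φ
  refine le_antisymm ?_ fun g hg => ?_
  · rintro _ ⟨g, hg, rfl⟩
    exact hH φ g hg
  · exact ⟨φ.symm g, hH φ.symm g hg, φ.apply_symm_apply g⟩

theorem mem_regularSubgroup_update_pred {n : ℕ} {lam m : Fin n → ℕ} {i : Fin n}
    {g : Π i : Fin n, ZMod (2 ^ lam i)} :
    g ∈ regularSubgroup lam (Function.update m i (m i - 1)) ↔
      g ∈ regularSubgroup lam m ∧ 2 ^ (m i - 1) • g i = 0 := by
  refine ⟨fun h => ?_, fun ⟨h, hi⟩ k => ?_⟩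
  · have hi : 2 ^ (m i - 1) • g i = 0 := by simpa using h i
    refine ⟨fun k => ?_, hi⟩
    rcases eq_or_ne k i with rfl | hk
    · exact ZMod.two_pow_nsmul_eq_zero_of_le (Nat.sub_le _ _) hi
    · simpa [hk] using h k
  · rcases eq_or_ne k i with rfl | hk
    · simpa using hi
    · simpa [hk] using h k

theorem IsCanonical.update_pred {n : ℕ} {lam m : Fin n → ℕ} (hm : IsCanonical lam m)
    {i : Fin n} (hi : ¬ DegenAt lam m i) :
    IsCanonical lam (Function.update m i (m i - 1)) := by
  intro j k hjk
  have h := hm j k hjk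
  simp only [DegenAt, not_or, not_exists, not_and] at hi
  obtain ⟨-, hi2, hi3⟩ := hi
  rcases eq_or_ne j i with rfl | hj
  · have hk : k ≠ j := by rintro rfl; omega
    have := hi3 k hjk
    simp only [Function.update_self, Function.update_of_ne hk]
    omega
  · rcases eq_or_ne k i with rfl | hk
    · have := hi2 j hjk
      simp only [Function.update_self, Function.update_of_ne hj]
      omega
    · simpa only [Function.update_of_ne hk, Function.update_of_ne hj] using h

/-- At a nondegenerate coordinate every automorphism preserves the leading binary digit. -/
theorem two_pow_nsmul_map_sub_eq_zero {n : ℕ} {lam m : Fin n → ℕ} (hcan : IsCanonical lam m)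
    (hm : ∀ i, m i ≤ lam i) {i : Fin n} (hi : ¬ DegenAt lam m i)
    (φ : AddAut (Π i : Fin n, ZMod (2 ^ lam i))) {g : Π i : Fin n, ZMod (2 ^ lam i)}
    (hg : g ∈ regularSubgroup lam m) : 2 ^ (m i - 1) • (φ g - g) i = 0 := by
  have hb := hcan.update_pred hi
  have hbl : ∀ k, Function.update m i (m i - 1) k ≤ lam k := fun k => by
    rcases eq_or_ne k i with rfl | hk
    · rw [Function.update_self]
      exact (Nat.sub_le _ _).trans (hm k)
    · rw [Function.update_of_ne hk]
      exact hm k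
  have key : ∀ (ψ : AddAut (Π i : Fin n, ZMod (2 ^ lam i))) (x : Π i : Fin n, ZMod (2 ^ lam i)),
      x ∈ regularSubgroup lam m → 2 ^ (m i - 1) • x i = 0 → 2 ^ (m i - 1) • ψ x i = 0 :=
    fun ψ x hx hxi => (mem_regularSubgroup_update_pred.1
      (hb.map_mem_regularSubgroup hbl ψ.toAddMonoidHom
        (mem_regularSubgroup_update_pred.2 ⟨hx, hxi⟩))).2
  have hφg : φ g ∈ regularSubgroup lam m :=
    hcan.map_mem_regularSubgroup hm φ.toAddMonoidHom hg
  by_cases h0 : 2 ^ (m i - 1) • g i = 0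
  · rw [Pi.sub_apply, nsmul_sub, key φ g hg h0, h0, sub_zero]
  · have h1 : 2 ^ (m i - 1) • φ g i ≠ 0 := fun h => h0 <| by
      simpa only [AddEquiv.symm_apply_apply] using key φ.symm (φ g) hφg h
    have hpos : m i - 1 + 1 = m i := by
      have : m i ≠ 0 := fun h => h0 (by simpa [h] using hg i)
      omega
    rw [Pi.sub_apply, sub_eq_add_neg]
    refine ZMod.two_pow_nsmul_add_eq_zero ?_ h1 ?_ ?_
    · rw [hpos]; exact hφg i
    · rw [hpos, smul_neg, hg i, neg_zero]
    · rwa [smul_neg, neg_ne_zero]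

theorem ZMod.exists_addMonoidHom_injective {l k : ℕ} (h : l ≤ k) :
    ∃ f : ZMod (2 ^ l) →+ ZMod (2 ^ k), Function.Injective f := by
  have hz : zmultiplesHom (ZMod (2 ^ k)) ((2 ^ (k - l) : ℕ) : ZMod (2 ^ k))
      ((2 ^ l : ℕ) : ℤ) = 0 := by
    rw [zmultiplesHom_apply, natCast_zsmul, nsmul_eq_mul, ← Nat.cast_mul, ← pow_add,
      Nat.add_sub_cancel' h, ZMod.natCast_self]
  refine ⟨ZMod.lift (2 ^ l) ⟨_, hz⟩, (ZMod.lift_injective _).2 fun z hzero => ?_⟩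
  rw [ZMod.intCast_zmod_eq_zero_iff_dvd]
  simp only [zmultiplesHom_apply, zsmul_eq_mul] at hzero
  rw [← Int.cast_natCast, ← Int.cast_mul, ZMod.intCast_zmod_eq_zero_iff_dvd] at hzero
  have h2 : (2 : ℤ) ^ l * 2 ^ (k - l) ∣ z * 2 ^ (k - l) := by
    rw [← pow_add, Nat.add_sub_cancel' h]
    exact_mod_cast hzero
  exact_mod_cast Int.dvd_of_mul_dvd_mul_right (by positivity) h2

theorem ZMod.exists_addMonoidHom_ker {l k : ℕ} (h : k ≤ l) :
    ∃ f : ZMod (2 ^ l) →+ ZMod (2 ^ k), ∀ x, f x = 0 → 2 ^ (l - k) • x = 0 := by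
  refine ⟨(ZMod.castHom (pow_dvd_pow 2 h) (ZMod (2 ^ k))).toAddMonoidHom, fun x hx => ?_⟩
  have hx' : ((x.val : ℕ) : ZMod (2 ^ k)) = 0 := by
    rw [ZMod.natCast_val]; exact hx
  rw [ZMod.natCast_eq_zero_iff] at hx'
  rw [← ZMod.natCast_zmod_val x, nsmul_eq_mul, ← Nat.cast_mul, ZMod.natCast_eq_zero_iff]
  calc 2 ^ l = 2 ^ (l - k) * 2 ^ k := by rw [← pow_add, Nat.sub_add_cancel h]
    _ ∣ _ := Nat.mul_dvd_mul_left _ hx'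

/-- The automorphism adding the image of the `j`-th component to the `i`-th component. -/
def transvectionAut {n : ℕ} {lam : Fin n → ℕ} {i j : Fin n} (hij : j ≠ i)
    (f : ZMod (2 ^ lam j) →+ ZMod (2 ^ lam i)) : AddAut (Π i : Fin n, ZMod (2 ^ lam i)) where
  toFun g := g + Pi.single i (f (g j))
  invFun g := g - Pi.single i (f (g j))
  left_inv g := by simp [hij]
  right_inv g := by simp [hij]
  map_add' g h := by
    rw [Pi.add_apply, map_add, Pi.single_add]
    abel

theorem IsCharSub.single_map_mem {n : ℕ} {lam : Fin n → ℕ}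
    {H : AddSubgroup (Π i : Fin n, ZMod (2 ^ lam i))} (hH : IsCharSub H) {i j : Fin n}
    (hij : j ≠ i) (f : ZMod (2 ^ lam j) →+ ZMod (2 ^ lam i))
    {h : Π i : Fin n, ZMod (2 ^ lam i)} (hh : h ∈ H) : Pi.single i (f (h j)) ∈ H := by
  have := H.sub_mem (hH.map_mem (transvectionAut hij f) hh) hh
  simpa [transvectionAut] using this

theorem IsCharSub.single_two_nsmul_mem {n : ℕ} {lam : Fin n → ℕ}
    {H : AddSubgroup (Π i : Fin n, ZMod (2 ^ lam i))} (hH : IsCharSub H) (i : Fin n)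
    {h : Π i : Fin n, ZMod (2 ^ lam i)} (hh : h ∈ H) : Pi.single i (2 • h i) ∈ H := by
  let φ : AddAut (Π i : Fin n, ZMod (2 ^ lam i)) :=
    AddEquiv.piCongrRight fun k => if k = i then AddEquiv.neg _ else AddEquiv.refl _
  have := H.sub_mem hh (hH.map_mem φ hh)
  convert this using 1
  ext k
  rcases eq_or_ne k i with rfl | hk
  · simp [φ, two_mul]
  · simp [φ, hk]

theorem IsCharSub.single_mem_of_two_pow_nsmul {n : ℕ} {lam : Fin n → ℕ}
    {H : AddSubgroup (Π i : Fin n, ZMod (2 ^ lam i))} (hH : IsCharSub H) {i : Fin n} {a : ℕ}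
    {h : Π i : Fin n, ZMod (2 ^ lam i)} (hh : h ∈ H) (ha : 2 ^ a • h i ≠ 0)
    {y : ZMod (2 ^ lam i)} (hy : 2 ^ a • y = 0) : Pi.single i y ∈ H := by
  cases a with
  | zero =>
    rw [pow_zero, one_nsmul] at hy
    rw [hy, Pi.single_zero]
    exact H.zero_mem
  | succ a =>
    rw [pow_succ, mul_nsmul'] at ha
    obtain ⟨k, rfl⟩ := ZMod.exists_eq_nsmul ha hy
    rw [Pi.single_smul]
    exact H.nsmul_mem (hH.single_two_nsmul_mem i hh) k

theorem two_pow_nsmul_ne_zero_of_addOrderOf {G : Type*} [AddMonoid G] {x : G} {a b : ℕ}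
    (hx : addOrderOf x = 2 ^ a) (hba : b < a) : 2 ^ b • x ≠ 0 := by
  intro h
  have := addOrderOf_dvd_of_nsmul_eq_zero h
  rw [hx, Nat.pow_dvd_pow_iff_le_right (by norm_num)] at this
  omega

theorem mem_of_forall_single_mem {n : ℕ} {lam : Fin n → ℕ}
    {H : AddSubgroup (Π i : Fin n, ZMod (2 ^ lam i))} {g : Π i : Fin n, ZMod (2 ^ lam i)}
    (hg : ∀ i, Pi.single i (g i) ∈ H) : g ∈ H := by
  rw [← Finset.univ_sum_single g]
  exact sum_mem fun i _ => hg i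

/-- A characteristic subgroup is a union of types. -/
theorem IsCharSub.typeSet_subset {n : ℕ} {lam a : Fin n → ℕ}
    {H : AddSubgroup (Π i : Fin n, ZMod (2 ^ lam i))} (hH : IsCharSub H)
    {g : Π i : Fin n, ZMod (2 ^ lam i)} (hg : g ∈ H) (hga : g ∈ typeSet 2 lam a) :
    typeSet 2 lam a ⊆ H := by
  intro h hh
  rw [← sub_add_cancel h g]
  refine H.add_mem (mem_of_forall_single_mem fun i => ?_) hg
  have h1 := hga i
  have h2 := hh i
  rw [Pi.sub_apply]
  cases hai : a i with
  | zero =>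
    rw [hai, pow_zero, AddMonoid.addOrderOf_eq_one_iff] at h1 h2
    rw [h1, h2, sub_zero, Pi.single_zero]
    exact H.zero_mem
  | succ c =>
    rw [hai] at h1 h2
    refine hH.single_mem_of_two_pow_nsmul hg
      (two_pow_nsmul_ne_zero_of_addOrderOf h1 c.lt_succ_self) ?_
    rw [sub_eq_add_neg]
    refine ZMod.two_pow_nsmul_add_eq_zero (h2 ▸ addOrderOf_nsmul_eq_zero _)
      (two_pow_nsmul_ne_zero_of_addOrderOf h2 c.lt_succ_self) ?_ ?_
    · rw [← h1, smul_neg, addOrderOf_nsmul_eq_zero, neg_zero]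
    · rw [smul_neg, neg_ne_zero]
      exact two_pow_nsmul_ne_zero_of_addOrderOf h1 c.lt_succ_self

theorem typeSet_nonempty {n : ℕ} {lam a : Fin n → ℕ} (ha : ∀ i, a i ≤ lam i) :
    (typeSet 2 lam a).Nonempty := by
  have (i : Fin n) : ∃ x : ZMod (2 ^ lam i), addOrderOf x = 2 ^ a i := by
    cases hai : a i with
    | zero => exact ⟨0, by simp⟩
    | succ c =>
      obtain ⟨x, hx, hx'⟩ := ZMod.exists_two_pow_nsmul_ne_zero c.succ_pos (hai ▸ ha i)
      exact ⟨x, addOrderOf_eq_prime_pow hx' hx⟩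
  choose g hg using this
  exact ⟨g, hg⟩

theorem exists_mem_typeSet {n : ℕ} {lam : Fin n → ℕ} (g : Π i : Fin n, ZMod (2 ^ lam i)) :
    ∃ a : Fin n → ℕ, (∀ i, a i ≤ lam i) ∧ g ∈ typeSet 2 lam a := by
  choose a ha hga using fun i => ZMod.exists_addOrderOf_eq_two_pow (lam i) (g i)
  exact ⟨a, ha, hga⟩

/-- A characteristic subgroup is below `m` iff it lies in the regular subgroup of `m` and attains
every order `2 ^ m i`. -/
theorem IsCharSub.below_iff {n : ℕ} {lam m : Fin n → ℕ}
    {H : AddSubgroup (Π i : Fin n, ZMod (2 ^ lam i))} (hH : IsCharSub H) :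
    (∀ i : Fin n,
      (∃ a : Fin n → ℕ, (∀ k, a k ≤ lam k) ∧ typeSet 2 lam a ⊆ ↑H ∧ a i = m i) ∧
      (∀ a : Fin n → ℕ, (∀ k, a k ≤ lam k) → typeSet 2 lam a ⊆ ↑H → a i ≤ m i)) ↔
    H ≤ regularSubgroup lam m ∧ ∀ i, 0 < m i → ∃ g ∈ H, 2 ^ (m i - 1) • g i ≠ 0 := by
  constructor
  · refine fun h => ⟨fun g hg i => ?_, fun i hi => ?_⟩
    · obtain ⟨a, ha, hga⟩ := exists_mem_typeSet g
      exact ZMod.two_pow_nsmul_eq_zero_of_le ((h i).2 a ha (hH.typeSet_subset hg hga))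
        (hga i ▸ addOrderOf_nsmul_eq_zero (g i))
    · obtain ⟨⟨a, ha, haH, hai⟩, -⟩ := h i
      obtain ⟨g, hg⟩ := typeSet_nonempty ha
      exact ⟨g, haH hg, two_pow_nsmul_ne_zero_of_addOrderOf (hg i) (by omega)⟩
  · rintro ⟨hle, hex⟩ i
    have upper : ∀ a : Fin n → ℕ, (∀ k, a k ≤ lam k) → typeSet 2 lam a ⊆ ↑H → a i ≤ m i := by
      intro a ha haH
      obtain ⟨g, hg⟩ := typeSet_nonempty ha
      by_contra! hlt
      exact two_pow_nsmul_ne_zero_of_addOrderOf (hg i) hlt (hle (haH hg) i)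
    refine ⟨?_, upper⟩
    obtain ⟨g, hg, hgi⟩ : ∃ g ∈ H, 0 < m i → 2 ^ (m i - 1) • g i ≠ 0 := by
      rcases (m i).eq_zero_or_pos with h0 | hpos
      · exact ⟨0, H.zero_mem, fun h => absurd h0 h.ne'⟩
      · obtain ⟨g, hg, hgi⟩ := hex i hpos
        exact ⟨g, hg, fun _ => hgi⟩
    obtain ⟨a, ha, hga⟩ := exists_mem_typeSet g
    have haH := hH.typeSet_subset hg hga
    refine ⟨a, ha, haH, le_antisymm (upper a ha haH) ?_⟩
    by_contra! hlt
    exact hgi (by omega) (ZMod.two_pow_nsmul_eq_zero_of_le (Nat.le_sub_one_of_lt hlt)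
      (hga i ▸ addOrderOf_nsmul_eq_zero (g i)))

/-- A characteristic subgroup attaining all the orders `2 ^ m i` contains every element of the
regular subgroup whose leading binary digits vanish at the nondegenerate coordinates. -/
theorem IsCharSub.mem_of_two_pow_nsmul_eq_zero {n : ℕ} {lam m : Fin n → ℕ} (hlam : Monotone lam)
    {H : AddSubgroup (Π i : Fin n, ZMod (2 ^ lam i))}
    (hH : IsCharSub H) (hex : ∀ i, 0 < m i → ∃ g ∈ H, 2 ^ (m i - 1) • g i ≠ 0)
    {g : Π i : Fin n, ZMod (2 ^ lam i)} (hg : g ∈ regularSubgroup lam m)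
    (hgi : ∀ i, ¬ DegenAt lam m i → 2 ^ (m i - 1) • g i = 0) : g ∈ H := by
  refine mem_of_forall_single_mem fun i => ?_
  have hgm := hg i
  rcases (m i).eq_zero_or_pos with h0 | hpos
  · rw [h0, pow_zero, one_nsmul] at hgm
    rw [hgm, Pi.single_zero]
    exact H.zero_mem
  have of_single {x : ZMod (2 ^ lam i)} (hxH : Pi.single i x ∈ H)
      (hx : 2 ^ (m i - 1) • x ≠ 0) : Pi.single i (g i) ∈ H := by
    obtain ⟨k, hk⟩ := ZMod.exists_eq_nsmul (y := g i) hx (by rwa [Nat.sub_add_cancel hpos])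
    rw [hk, Pi.single_smul]
    exact H.nsmul_mem hxH k
  by_cases hd : DegenAt lam m i
  · rcases hd with ⟨-, h0⟩ | ⟨j, hji, hmj⟩ | ⟨j, hij, hmj⟩
    · omega
    · obtain ⟨f, hf⟩ := ZMod.exists_addMonoidHom_injective
        (hlam (show j ≤ i from Fin.le_def.2 (by omega)))
      obtain ⟨h, hh, hhj⟩ := hex j (hmj ▸ hpos)
      refine of_single (hH.single_map_mem (by rintro rfl; omega) f hh) ?_
      rwa [← map_nsmul, map_ne_zero_iff f hf, hmj]
    · have hle := hlam (show i ≤ j from Fin.le_def.2 (by omega))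
      obtain ⟨f, hf⟩ := ZMod.exists_addMonoidHom_ker hle
      obtain ⟨h, hh, hhj⟩ := hex j (by omega)
      refine of_single (hH.single_map_mem (by rintro rfl; omega) f hh) fun h0 => hhj ?_
      rw [← map_nsmul] at h0
      have := hf _ h0
      rwa [← mul_nsmul', ← pow_add, show lam j - lam i + (m i - 1) = m j - 1 by omega] at this
  · obtain ⟨h, hh, hhi⟩ := hex i hpos
    exact hH.single_mem_of_two_pow_nsmul hh hhi (hgi i hd)

open Classical in
/-- The leading binary digits, at the coordinates `e k`, of an element of a regular subgroup. -/
noncomputable def leadingDigits {n r : ℕ} (lam m : Fin n → ℕ) (e : Fin r → Fin n) :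
    regularSubgroup lam m →+ (Fin r → ZMod 2) :=
  AddMonoidHom.mk'
    (fun g k => if 2 ^ (m (e k) - 1) • (g : Π i : Fin n, ZMod (2 ^ lam i)) (e k) = 0 then 0 else 1)
    (by
      intro g h
      ext k
      have hg := g.2 (e k)
      have hh := h.2 (e k)
      simp only [AddSubgroup.coe_add, Pi.add_apply]
      by_cases hg0 : 2 ^ (m (e k) - 1) • (g : Π i : Fin n, ZMod (2 ^ lam i)) (e k) = 0
      · simp only [nsmul_add, hg0, zero_add, if_true]
      by_cases hh0 : 2 ^ (m (e k) - 1) • (h : Π i : Fin n, ZMod (2 ^ lam i)) (e k) = 0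
      · simp only [nsmul_add, hh0, add_zero, if_true]
      have hpos : m (e k) - 1 + 1 = m (e k) := by
        have : m (e k) ≠ 0 := fun h => hg0 (by simpa [h] using hg)
        omega
      rw [if_pos (ZMod.two_pow_nsmul_add_eq_zero (by rwa [hpos]) hg0 (by rwa [hpos]) hh0),
        if_neg hg0, if_neg hh0]
      rfl)

theorem leadingDigits_apply_eq_zero_iff {n r : ℕ} {lam m : Fin n → ℕ} {e : Fin r → Fin n}
    {g : regularSubgroup lam m} {k : Fin r} :
    leadingDigits lam m e g k = 0 ↔
      2 ^ (m (e k) - 1) • (g : Π i : Fin n, ZMod (2 ^ lam i)) (e k) = 0 := by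
  simp [leadingDigits]

theorem ZMod.two_eq_of_eq_zero_iff {a b : ZMod 2} (h : a = 0 ↔ b = 0) : a = b := by
  revert a b
  decide

theorem leadingDigits_surjective {n r : ℕ} {lam m : Fin n → ℕ} (hm : ∀ i, m i ≤ lam i)
    {e : Fin r → Fin n} (he : Function.Injective e) (hpos : ∀ k, 0 < m (e k)) :
    Function.Surjective (leadingDigits lam m e) := by
  classical
  intro v
  have (i : Fin n) : ∃ x : ZMod (2 ^ lam i), 2 ^ m i • x = 0 ∧
      (0 < m i → (2 ^ (m i - 1) • x = 0 ↔ ∀ k, e k = i → v k = 0)) := by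
    by_cases h : ∀ k, e k = i → v k = 0
    · exact ⟨0, by simp, fun _ => by simpa using h⟩
    · rcases (m i).eq_zero_or_pos with h0 | hi
      · exact ⟨0, by simp, by omega⟩
      obtain ⟨x, hx, hx'⟩ := ZMod.exists_two_pow_nsmul_ne_zero hi (hm i)
      exact ⟨x, hx, fun _ => iff_of_false hx' h⟩
  choose g hg hgv using this
  refine ⟨⟨g, hg⟩, funext fun k => ZMod.two_eq_of_eq_zero_iff ?_⟩
  rw [leadingDigits_apply_eq_zero_iff, hgv _ (hpos k)]
  exact ⟨fun h => h k rfl, fun h j hj => he hj ▸ h⟩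

theorem AddSubgroup.map_eval_eq_top_iff {r : ℕ} {K : AddSubgroup (Fin r → ZMod 2)} {k : Fin r} :
    AddSubgroup.map (Pi.evalAddMonoidHom (fun _ => ZMod 2) k) K = ⊤ ↔ ∃ v ∈ K, v k ≠ 0 := by
  constructor
  · intro h
    obtain ⟨v, hv, hvk⟩ : (1 : ZMod 2) ∈ AddSubgroup.map (Pi.evalAddMonoidHom _ k) K := by
      rw [h]; trivial
    exact ⟨v, hv, by rw [show v k = 1 from hvk]; decide⟩
  · rintro ⟨v, hv, hvk⟩
    rw [eq_top_iff]
    rintro x -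
    by_cases hx : x = 0
    · exact hx ▸ zero_mem _
    · exact ⟨v, hv, ZMod.two_eq_of_eq_zero_iff (iff_of_false hvk hx)⟩

theorem pos_of_not_degenAt {n : ℕ} {lam m : Fin n → ℕ} (hcan : IsCanonical lam m) {i : Fin n}
    (hi : ¬ DegenAt lam m i) : 0 < m i := by
  simp only [DegenAt, not_or, not_exists, not_and] at hi
  obtain ⟨h1, h2, -⟩ := hi
  by_contra! h0
  rcases Nat.eq_zero_or_pos (i : ℕ) with hi0 | hi0
  · exact h1 hi0 (by omega)
  · have hj : ((⟨i - 1, by omega⟩ : Fin n) : ℕ) + 1 = i := Nat.sub_add_cancel hi0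
    have := (hcan _ _ hj).1
    exact h2 _ hj (by omega)

theorem stmt_9 (n : ℕ) (hn : 0 < n) (lam : Fin n → ℕ)
    (hlam1 : ∀ i, 1 ≤ lam i) (hlam : Monotone lam)
    (m : Fin n → ℕ) (hm : ∀ i, m i ≤ lam i) (hcan : IsCanonical lam m)
    (r : ℕ) (hr : r = Nat.card {i : Fin n // ¬ DegenAt lam m i}) :
    Nat.card {H : AddSubgroup (Π i : Fin n, ZMod (2 ^ lam i)) //
        IsCharSub H ∧ ∀ i : Fin n,
          (∃ a : Fin n → ℕ, (∀ k, a k ≤ lam k) ∧ typeSet 2 lam a ⊆ ↑H ∧ a i = m i) ∧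
          (∀ a : Fin n → ℕ, (∀ k, a k ≤ lam k) → typeSet 2 lam a ⊆ ↑H → a i ≤ m i)} =
    Nat.card {K : AddSubgroup (Fin r → ZMod 2) //
        ∀ i : Fin r, AddSubgroup.map (Pi.evalAddMonoidHom (fun _ => ZMod 2) i) K = ⊤} := by
  have e := (Finite.equivFinOfCardEq hr.symm).symm
  let c : Fin r → Fin n := fun k => e k
  have hc : ∀ k, ¬ DegenAt lam m (c k) := fun k => (e k).2
  have hcs : ∀ i, ¬ DegenAt lam m i → ∃ k, c k = i := fun i hi =>
    ⟨e.symm ⟨i, hi⟩, by simp [c]⟩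
  have hpos : ∀ k, 0 < m (c k) := fun k => pos_of_not_degenAt hcan (hc k)
  have hcinj : Function.Injective c := Subtype.val_injective.comp e.injective
  let R := regularSubgroup lam m
  let ψ : R →+ (Fin r → ZMod 2) := leadingDigits lam m c
  have hψ : Function.Surjective ψ := leadingDigits_surjective hm hcinj hpos
  have hψker : ∀ g : R, ψ g = 0 ↔
      ∀ i, ¬ DegenAt lam m i → 2 ^ (m i - 1) • (g : Π i : Fin n, ZMod (2 ^ lam i)) i = 0 := by
    intro g
    constructor
    · intro h i hi
      obtain ⟨k, rfl⟩ := hcs i hi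
      exact leadingDigits_apply_eq_zero_iff.1 (congrFun h k)
    · exact fun h => funext fun k => leadingDigits_apply_eq_zero_iff.2 (h _ (hc k))
  have ker_le : ∀ H : AddSubgroup (Π i : Fin n, ZMod (2 ^ lam i)), IsCharSub H →
      (∀ i, 0 < m i → ∃ g ∈ H, 2 ^ (m i - 1) • g i ≠ 0) → ψ.ker ≤ H.addSubgroupOf R :=
    fun H hH hex g hg => hH.mem_of_two_pow_nsmul_eq_zero hlam hex g.2 ((hψker g).1 hg)
  have hchar : ∀ K : AddSubgroup (Fin r → ZMod 2), IsCharSub ((K.comap ψ).map R.subtype) := by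
    refine fun K => isCharSub_of_forall_map_mem fun φ => ?_
    rintro _ ⟨g, hg, rfl⟩
    refine ⟨⟨φ g, hcan.map_mem_regularSubgroup hm φ.toAddMonoidHom g.2⟩, ?_, rfl⟩
    have h0 : ψ (⟨φ g, hcan.map_mem_regularSubgroup hm φ.toAddMonoidHom g.2⟩ - g) = 0 :=
      (hψker _).2 fun i hi => two_pow_nsmul_map_sub_eq_zero hcan hm hi φ g.2
    rw [map_sub, sub_eq_zero] at h0
    exact AddSubgroup.mem_comap.2 (h0.symm ▸ hg)
  refine Nat.card_congr ⟨fun H => ⟨(H.1.addSubgroupOf R).map ψ, fun k => ?_⟩,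
    fun K => ⟨(K.1.comap ψ).map R.subtype, hchar K, (hchar K).below_iff.2 ⟨?_, fun i hi => ?_⟩⟩,
    fun H => Subtype.ext ?_, fun K => Subtype.ext ?_⟩
  · obtain ⟨H, hH, hbelow⟩ := H
    obtain ⟨hle, hex⟩ := hH.below_iff.1 hbelow
    obtain ⟨g, hg, hgk⟩ := hex _ (hpos k)
    exact AddSubgroup.map_eval_eq_top_iff.2
      ⟨ψ ⟨g, hle hg⟩, ⟨⟨g, hle hg⟩, hg, rfl⟩, fun h => hgk (leadingDigits_apply_eq_zero_iff.1 h)⟩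
  · rintro _ ⟨g, -, rfl⟩
    exact g.2
  · by_cases hd : DegenAt lam m i
    · obtain ⟨x, hx, hx'⟩ := ZMod.exists_two_pow_nsmul_ne_zero hi (hm i)
      have hxR : Pi.single i x ∈ R := fun k => by
        rw [← Pi.smul_apply, ← Pi.single_smul]
        rcases eq_or_ne k i with rfl | hk
        · rw [Pi.single_eq_same, hx]
        · rw [Pi.single_eq_of_ne hk]
      refine ⟨Pi.single i x, ⟨⟨Pi.single i x, hxR⟩, ?_, rfl⟩, by rwa [Pi.single_eq_same]⟩
      have h0 : ψ ⟨Pi.single i x, hxR⟩ = 0 := (hψker _).2 fun k hk => by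
        change 2 ^ (m k - 1) • (Pi.single i x : Π i : Fin n, ZMod (2 ^ lam i)) k = 0
        rw [Pi.single_eq_of_ne (by rintro rfl; exact hk hd), smul_zero]
      exact AddSubgroup.mem_comap.2 (h0 ▸ K.1.zero_mem)
    · obtain ⟨k, rfl⟩ := hcs i hd
      obtain ⟨v, hv, hvk⟩ := AddSubgroup.map_eval_eq_top_iff.1 (K.2 k)
      obtain ⟨g, rfl⟩ := hψ v
      exact ⟨g, ⟨g, hv, rfl⟩, fun h => hvk (leadingDigits_apply_eq_zero_iff.2 h)⟩
  · obtain ⟨H, hH, hbelow⟩ := H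
    obtain ⟨hle, hex⟩ := hH.below_iff.1 hbelow
    change (((H.addSubgroupOf R).map ψ).comap ψ).map R.subtype = H
    rw [AddSubgroup.comap_map_eq_self (ker_le H hH hex), AddSubgroup.addSubgroupOf_map_subtype,
      inf_eq_left.2 hle]
  · change (((K.1.comap ψ).map R.subtype).addSubgroupOf R).map ψ = K.1
    rw [AddSubgroup.addSubgroupOf, AddSubgroup.comap_map_eq_self_of_injective R.subtype_injective,
      AddSubgroup.map_comap_eq_self_of_surjective hψ]
end

section
/- For every k ≥ 0, the number n_k of projection-surjective subgroups of (Z_2)^k satisfies, as an identity in ℤ, n_k = ∑_{i=0}^k (−1)^{i+k} C(k, i) ∑_{j=0}^i [i choose j]_2, where C(k, i) is the ordinary binomial coefficient and [i choose j]_2 = (∏_{l=0}^{j−1} (2^{i−l} − 1)) / (∏_{l=1}^{j} (2^l − 1)) is the Gaussian binomial coefficient (a natural number, equal to the number of j-dimensional subspaces of an i-dimensional vector space over the field with 2 elements). -/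
/-- The Gaussian binomial coefficient `[i choose j]_2`. -/
def gaussBinom (i j : ℕ) : ℕ :=
  (∏ l ∈ Finset.range j, (2 ^ (i - l) - 1)) / ∏ l ∈ Finset.range j, (2 ^ (l + 1) - 1)

/-- Linearly independent families with a given span are the linearly independent families in the
span, as long as the cardinality matches the dimension. -/
def linearIndependentFiberEquiv {K V : Type*} [Field K] [AddCommGroup V] [Module K V]
    [FiniteDimensional K V] {j : ℕ} (W : {W : Submodule K V // Module.finrank K W = j}) :
    {s : {s : Fin j → V // LinearIndependent K s} // Submodule.span K (Set.range s.1) = W.1} ≃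
      {s : Fin j → W.1 // LinearIndependent K s} where
  toFun s := ⟨fun a => ⟨s.1.1 a, s.2.le (Submodule.subset_span ⟨a, rfl⟩)⟩,
    LinearIndependent.of_comp W.1.subtype s.1.2⟩
  invFun s := ⟨⟨fun a => s.1 a, s.2.map' W.1.subtype W.1.ker_subtype⟩, by
    have hli := s.2.map' W.1.subtype W.1.ker_subtype
    refine Submodule.eq_of_le_of_finrank_eq ?_ ?_
    · rw [Submodule.span_le]
      rintro _ ⟨a, rfl⟩
      exact (s.1 a).2
    · rw [W.2]
      exact (finrank_span_eq_card hli).trans (Fintype.card_fin j)⟩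
  left_inv _ := rfl
  right_inv _ := rfl

theorem card_submodule_finrank_eq_mul_card_linearIndependent {K V : Type*} [Field K] [Fintype K]
    [AddCommGroup V] [Module K V] [Finite V] (j : ℕ) :
    Nat.card {W : Submodule K V // Module.finrank K W = j} *
      ∏ l : Fin j, (Fintype.card K ^ j - Fintype.card K ^ l.val) =
    Nat.card {s : Fin j → V // LinearIndependent K s} := by
  have := Fintype.ofFinite {W : Submodule K V // Module.finrank K W = j}
  let f : {s : Fin j → V // LinearIndependent K s} →
      {W : Submodule K V // Module.finrank K W = j} :=
    fun s => ⟨Submodule.span K (Set.range s.1),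
      (finrank_span_eq_card s.2).trans (Fintype.card_fin j)⟩
  rw [← Nat.card_congr (Equiv.sigmaFiberEquiv f), Nat.card_sigma, Finset.sum_const_nat,
    Finset.card_univ, Nat.card_eq_fintype_card]
  intro W _
  have e : {s // f s = W} ≃ {s : Fin j → W.1 // LinearIndependent K s} :=
    (Equiv.subtypeEquivRight fun s => Subtype.ext_iff).trans (linearIndependentFiberEquiv W)
  rw [Nat.card_congr e, card_linearIndependent W.2.ge, W.2]

theorem prod_two_pow_sub {j n : ℕ} (h : j ≤ n) :
    ∏ l : Fin j, (2 ^ n - 2 ^ l.val) =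
      (∏ l ∈ Finset.range j, 2 ^ l) * ∏ l ∈ Finset.range j, (2 ^ (n - l) - 1) := by
  rw [Fin.prod_univ_eq_prod_range (fun l => 2 ^ n - 2 ^ l), ← Finset.prod_mul_distrib]
  refine Finset.prod_congr rfl fun l hl => ?_
  rw [Nat.mul_sub, ← pow_add, mul_one, Nat.add_sub_cancel' ((Finset.mem_range.1 hl).le.trans h)]

theorem card_submodule_finrank_eq_gaussBinom {V : Type*} [AddCommGroup V] [Module (ZMod 2) V]
    [Finite V] {j : ℕ} (h : j ≤ Module.finrank (ZMod 2) V) :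
    Nat.card {W : Submodule (ZMod 2) V // Module.finrank (ZMod 2) W = j} =
      gaussBinom (Module.finrank (ZMod 2) V) j := by
  have key := card_submodule_finrank_eq_mul_card_linearIndependent (K := ZMod 2) (V := V) j
  rw [card_linearIndependent h, ZMod.card, prod_two_pow_sub le_rfl, prod_two_pow_sub h,
    mul_left_comm] at key
  have hrefl : ∏ l ∈ Finset.range j, (2 ^ (j - l) - 1) =
      ∏ l ∈ Finset.range j, (2 ^ (l + 1) - 1) := by
    rw [← Finset.prod_range_reflect]
    refine Finset.prod_congr rfl fun l hl => ?_
    rw [Finset.mem_range] at hl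
    congr 2
    omega
  have hpos : 0 < ∏ l ∈ Finset.range j, (2 ^ (l + 1) - 1) :=
    Finset.prod_pos fun l _ => Nat.sub_pos_of_lt (Nat.one_lt_two_pow l.succ_ne_zero)
  rw [hrefl] at key
  exact (Nat.div_eq_of_eq_mul_left hpos
    (Nat.eq_of_mul_eq_mul_left (Finset.prod_pos fun l _ => by positivity) key).symm).symm

theorem card_submodule_eq_sum_gaussBinom (V : Type*) [AddCommGroup V] [Module (ZMod 2) V]
    [Finite V] :
    Nat.card (Submodule (ZMod 2) V) =
      ∑ j ∈ Finset.range (Module.finrank (ZMod 2) V + 1),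
        gaussBinom (Module.finrank (ZMod 2) V) j := by
  classical
  have := Fintype.ofFinite (Submodule (ZMod 2) V)
  rw [Nat.card_eq_fintype_card, ← Finset.card_univ,
    Finset.card_eq_sum_card_fiberwise (f := fun W : Submodule (ZMod 2) V => Module.finrank (ZMod 2) W)
      (t := Finset.range (Module.finrank (ZMod 2) V + 1))]
  · refine Finset.sum_congr rfl fun j hj => ?_
    rw [← card_submodule_finrank_eq_gaussBinom (Nat.lt_succ_iff.1 (Finset.mem_range.1 hj)),
      Nat.card_eq_fintype_card, Fintype.card_subtype]
  · intro W _
    simpa [Nat.lt_succ_iff] using Submodule.finrank_le W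

theorem finrank_iInf_ker_proj {k : ℕ} (t : Finset (Fin k)) :
    Module.finrank (ZMod 2) (⨅ i ∈ (t : Set (Fin k)),
      LinearMap.ker (LinearMap.proj i : (Fin k → ZMod 2) →ₗ[ZMod 2] ZMod 2) :
        Submodule (ZMod 2) (Fin k → ZMod 2)) = k - t.card := by
  classical
  rw [(LinearMap.iInfKerProjEquiv (ZMod 2) (fun _ : Fin k => ZMod 2)
    (I := ((tᶜ : Finset (Fin k)) : Set (Fin k))) (J := (t : Set (Fin k)))
    (by simpa using disjoint_compl_left) (by simp)).finrank_eq]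
  simp

theorem card_addSubgroup_vanishing {k : ℕ} (t : Finset (Fin k)) :
    Nat.card {K : AddSubgroup (Fin k → ZMod 2) // ∀ i ∈ t, ∀ x ∈ K, x i = 0} =
      ∑ j ∈ Finset.range (k - t.card + 1), gaussBinom (k - t.card) j := by
  rw [← finrank_iInf_ker_proj t, ← card_submodule_eq_sum_gaussBinom]
  refine Nat.card_congr (Equiv.trans ?_ (Submodule.MapSubtype.orderIso _).toEquiv.symm)
  refine (AddSubgroup.toZModSubmodule 2).toEquiv.subtypeEquiv fun K => ?_
  simp only [le_iInf_iff]
  rfl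

theorem map_evalAddMonoidHom_eq_top_iff {k : ℕ} (K : AddSubgroup (Fin k → ZMod 2)) (i : Fin k) :
    AddSubgroup.map (Pi.evalAddMonoidHom (fun _ => ZMod 2) i) K = ⊤ ↔ ¬ ∀ x ∈ K, x i = 0 := by
  constructor
  · intro h hK
    obtain ⟨x, hx, h1⟩ : (1 : ZMod 2) ∈ AddSubgroup.map (Pi.evalAddMonoidHom _ i) K :=
      h ▸ AddSubgroup.mem_top _
    exact one_ne_zero (h1.symm.trans (hK x hx))
  · intro h
    push Not at h
    obtain ⟨x, hx, hne⟩ := h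
    rw [eq_top_iff]
    intro y _
    by_cases hy : y = 0
    · exact hy ▸ zero_mem _
    · refine ⟨x, hx, ?_⟩
      change x i = y
      exact (Fin.eq_one_of_ne_zero (x i) hne).trans (Fin.eq_one_of_ne_zero y hy).symm

theorem stmt_10 (k : ℕ) :
    (Nat.card {K : AddSubgroup (Fin k → ZMod 2) //
        ∀ i : Fin k, AddSubgroup.map (Pi.evalAddMonoidHom (fun _ => ZMod 2) i) K = ⊤} : ℤ) =
    ∑ i ∈ Finset.range (k + 1), (-1 : ℤ) ^ (i + k) * (Nat.choose k i) *
      ∑ j ∈ Finset.range (i + 1), (gaussBinom i j : ℤ) := by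
  classical
  have := Fintype.ofFinite (AddSubgroup (Fin k → ZMod 2))
  let S : Fin k → Finset (AddSubgroup (Fin k → ZMod 2)) :=
    fun i => {K | ∀ x ∈ K, x i = 0}
  have hS (t : Finset (Fin k)) :
      (t.inf S).card = ∑ j ∈ Finset.range (k - t.card + 1), gaussBinom (k - t.card) j := by
    rw [← card_addSubgroup_vanishing t, Nat.card_eq_fintype_card, Fintype.card_subtype]
    congr 1
    ext K
    simp [S, Finset.mem_inf]
  have hcompl : Nat.card {K : AddSubgroup (Fin k → ZMod 2) //
      ∀ i : Fin k, AddSubgroup.map (Pi.evalAddMonoidHom (fun _ => ZMod 2) i) K = ⊤} =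
      (Finset.univ.inf fun i => (S i)ᶜ).card := by
    rw [Nat.card_eq_fintype_card, Fintype.card_subtype]
    congr 1
    ext K
    simp [S, Finset.mem_inf, map_evalAddMonoidHom_eq_top_iff]
  rw [hcompl, Finset.inclusion_exclusion_card_inf_compl]
  simp only [hS]
  rw [Finset.sum_powerset_apply_card (fun m => (-1 : ℤ) ^ m *
    ((∑ j ∈ Finset.range (k - m + 1), gaussBinom (k - m) j : ℕ) : ℤ)), Finset.card_univ,
    Fintype.card_fin, ← Finset.sum_range_reflect]
  refine Finset.sum_congr rfl fun m hm => ?_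
  have hmk : m ≤ k := Nat.lt_succ_iff.1 (Finset.mem_range.1 hm)
  have hsign : (-1 : ℤ) ^ (k - m) = (-1) ^ (m + k) := by
    rw [show m + k = k - m + 2 * m by omega, pow_add, pow_mul]
    simp
  rw [show k + 1 - 1 - m = k - m by omega, Nat.choose_symm hmk, Nat.sub_sub_self hmk, hsign,
    nsmul_eq_mul]
  push_cast
  ring
end

section
/- Let p be an odd prime and G = Z_{p^{λ_1}} × ⋯ × Z_{p^{λ_n}} with 1 ≤ λ_1 ≤ ⋯ ≤ λ_n. Then for any i ∈ {1,…,n}, there is an order isomorphism between the set of characteristic subgroups of G and the set of characteristic subgroups of G × Z_{p^{λ_i}}, each ordered by inclusion. -/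
/-- A subgroup is fully invariant if it is mapped into itself by every endomorphism. -/
def IsFullyInvariantSub {G : Type*} [AddGroup G] (H : AddSubgroup G) : Prop :=
  ∀ φ : G →+ G, ∀ x ∈ H, φ x ∈ H

theorem isCharSub_iff {G : Type*} [AddGroup G] {H : AddSubgroup G} :
    IsCharSub H ↔ ∀ φ : G ≃+ G, ∀ x ∈ H, φ x ∈ H := by
  constructor
  · intro h φ x hx
    have : φ x ∈ AddSubgroup.map φ.toAddMonoidHom H := ⟨x, hx, rfl⟩
    rwa [h φ] at this
  · intro h φ
    apply le_antisymm
    · rintro _ ⟨x, hx, rfl⟩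
      exact h φ x hx
    · intro x hx
      exact ⟨AddEquiv.symm φ x, h (AddEquiv.symm φ) x hx, AddEquiv.apply_symm_apply φ x⟩

theorem IsFullyInvariantSub.isCharSub {G : Type*} [AddGroup G] {H : AddSubgroup G}
    (h : IsFullyInvariantSub H) : IsCharSub H :=
  isCharSub_iff.2 fun φ x hx => h φ.toAddMonoidHom x hx

/-- The shear automorphism adding `f (x j)` to the coordinate `k ≠ j`. -/
def piShear {ι : Type*} [DecidableEq ι] {A : ι → Type*} [∀ k, AddCommGroup (A k)]
    {j k : ι} (hjk : j ≠ k) (f : A j →+ A k) : (∀ k, A k) ≃+ (∀ k, A k) where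
  toFun x := x + Pi.single k (f (x j))
  invFun x := x - Pi.single k (f (x j))
  left_inv x := by simp [hjk]
  right_inv x := by simp [hjk]
  map_add' x y := by
    simp only [Pi.add_apply, map_add, Pi.single_add]
    abel

/-- The automorphism doubling the coordinate `k`, when `2` is a unit there. -/
def piDouble {ι : Type*} [DecidableEq ι] {N : ι → ℕ} {k : ι} (u : (ZMod (N k))ˣ)
    (hu : (u : ZMod (N k)) = 2) : (∀ k, ZMod (N k)) ≃+ (∀ k, ZMod (N k)) where
  toFun x := x + Pi.single k (x k)
  invFun x := x - Pi.single k (↑u⁻¹ * x k)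
  left_inv x := by
    have h : (↑u⁻¹ : ZMod (N k)) * (x k + x k) = x k := by
      rw [← two_mul, ← hu, Units.inv_mul_cancel_left]
    simp [h]
  right_inv x := by
    have h : (↑u⁻¹ : ZMod (N k)) * x k + ↑u⁻¹ * x k = x k := by
      rw [← two_mul, ← hu, Units.mul_inv_cancel_left]
    have h' : x k - ↑u⁻¹ * x k = ↑u⁻¹ * x k := sub_eq_of_eq_add h.symm
    simp [h']
  map_add' x y := by
    simp only [Pi.add_apply, Pi.single_add]
    abel

theorem IsCharSub.isFullyInvariantSub_pi {ι : Type*} [Fintype ι] {N : ι → ℕ}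
    (hN : ∀ k, Odd (N k)) {H : AddSubgroup (∀ k, ZMod (N k))} (hH : IsCharSub H) :
    IsFullyInvariantSub H := by
  classical
  rw [isCharSub_iff] at hH
  have elementary : ∀ (j k : ι) (f : ZMod (N j) →+ ZMod (N k)), ∀ x ∈ H,
      Pi.single k (f (x j)) ∈ H := by
    intro j k f x hx
    rcases eq_or_ne j k with rfl | hjk
    · have h2 : Nat.Coprime 2 (N j) := Nat.coprime_two_left.2 (hN j)
      have h := H.sub_mem (hH (piDouble (ZMod.unitOfCoprime 2 h2) (by simp)) x hx) hx
      have hs : Pi.single j (x j) ∈ H := by simpa [piDouble] using h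
      have : NeZero (N j) := ⟨(hN j).pos.ne'⟩
      have hf : f (x j) = (x j).val • f 1 := by
        rw [← map_nsmul]
        simp
      have hf' : f (x j) = (f 1).val • x j := by
        rw [hf]
        simp [mul_comm]
      rw [hf', Pi.single_smul]
      exact H.nsmul_mem hs _
    · simpa [piShear] using H.sub_mem (hH (piShear hjk f) x hx) hx
  intro φ x hx
  have key : φ x = ∑ k, ∑ j, Pi.single k (φ (Pi.single j (x j)) k) := by
    conv_lhs => rw [← Finset.univ_sum_single (φ x)]
    refine Finset.sum_congr rfl fun k _ => ?_
    conv_lhs => rw [← Finset.univ_sum_single x]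
    rw [map_sum, Finset.sum_apply]
    exact map_sum (AddMonoidHom.single (fun k => ZMod (N k)) k) _ _
  rw [key]
  exact H.sum_mem fun k _ => H.sum_mem fun j _ => elementary j k
    ((Pi.evalAddMonoidHom _ k).comp (φ.comp (AddMonoidHom.single (fun k => ZMod (N k)) j))) x hx

theorem IsCharSub.comap_equiv {G G' : Type*} [AddGroup G] [AddGroup G'] {H : AddSubgroup G}
    (hH : IsCharSub H) (e : G' ≃+ G) : IsCharSub (H.comap e.toAddMonoidHom) := by
  rw [isCharSub_iff] at hH ⊢
  intro φ x hx
  simpa using hH ((e.symm.trans φ).trans e) (e x) hx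

theorem IsFullyInvariantSub.of_comap_equiv {G G' : Type*} [AddGroup G] [AddGroup G']
    {H : AddSubgroup G} (e : G' ≃+ G) (hH : IsFullyInvariantSub (H.comap e.toAddMonoidHom)) :
    IsFullyInvariantSub H := by
  intro φ x hx
  simpa using hH (e.symm.toAddMonoidHom.comp (φ.comp e.toAddMonoidHom)) (e.symm x)
    (by simpa using hx)

theorem IsCharSub.isFullyInvariantSub_pi_prod {ι : Type*} [Fintype ι] {N : ι → ℕ} {M : ℕ}
    (hN : ∀ k, Odd (N k)) (hM : Odd M) {K : AddSubgroup ((∀ k, ZMod (N k)) × ZMod M)}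
    (hK : IsCharSub K) : IsFullyInvariantSub K := by
  let e : (∀ o : Option ι, ZMod (o.elim M N)) ≃+ (∀ k, ZMod (N k)) × ZMod M :=
    { (Equiv.piOptionEquivProd (β := fun o : Option ι => ZMod (o.elim M N))).trans
        (Equiv.prodComm _ _) with
      map_add' := fun _ _ => rfl }
  refine .of_comap_equiv e ((hK.comap_equiv e).isFullyInvariantSub_pi ?_)
  rintro (_ | k)
  exacts [hM, hN k]

/-- Adjoining a second copy of a direct summand does not change the ordered set of fully
invariant subgroups. -/
def fullyInvariantOrderIso {G A : Type*} [AddCommGroup G] [AddCommGroup A]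
    (s : A →+ G) (r : G →+ A) (hrs : ∀ a, r (s a) = a) :
    {H : AddSubgroup G // IsFullyInvariantSub H} ≃o
      {K : AddSubgroup (G × A) // IsFullyInvariantSub K} where
  toFun H := ⟨H.1.prod (H.1.comap s), by
    rintro φ ⟨g, a⟩ ⟨hg, ha⟩
    have fst_mem : ∀ ψ : G × A →+ G, ψ (g, a) ∈ H.1 := by
      intro ψ
      have h := H.1.add_mem (H.2 (ψ.comp (AddMonoidHom.inl G A)) g hg)
        (H.2 ((ψ.comp (AddMonoidHom.inr G A)).comp r) (s a) ha)
      simpa [hrs, ← map_add] using h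
    exact ⟨fst_mem ((AddMonoidHom.fst G A).comp φ),
      fst_mem (s.comp ((AddMonoidHom.snd G A).comp φ))⟩⟩
  invFun K := ⟨K.1.comap (AddMonoidHom.inl G A), fun φ x hx => by
    simpa using K.2 ((AddMonoidHom.inl G A).comp (φ.comp (AddMonoidHom.fst G A))) (x, 0) hx⟩
  left_inv H := by
    ext g
    simp [AddSubgroup.mem_prod]
  right_inv K := by
    ext ⟨g, a⟩
    simp only [AddSubgroup.mem_prod, AddSubgroup.mem_comap, AddMonoidHom.inl_apply]
    constructor
    · rintro ⟨hg, ha⟩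
      have h := K.2 ((AddMonoidHom.inr G A).comp (r.comp (AddMonoidHom.fst G A))) _ ha
      simpa [hrs] using K.1.add_mem hg h
    · intro h
      exact ⟨K.2 ((AddMonoidHom.inl G A).comp (AddMonoidHom.fst G A)) _ h,
        K.2 ((AddMonoidHom.inl G A).comp (s.comp (AddMonoidHom.snd G A))) _ h⟩
  map_rel_iff' {H H'} := by
    constructor
    · intro h g hg
      exact (h (show (g, (0 : A)) ∈ H.1.prod (H.1.comap s) from
        ⟨hg, by simp [H.1.zero_mem]⟩)).1
    · exact fun h x hx => ⟨h hx.1, h hx.2⟩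

theorem stmt_12 (p : ℕ) (hp : p.Prime) (hodd : p ≠ 2) (n : ℕ) (hn : 0 < n)
    (lam : Fin n → ℕ) (hlam1 : ∀ i, 1 ≤ lam i) (hlam : Monotone lam) (i : Fin n) :
    Nonempty ({H : AddSubgroup (Π k : Fin n, ZMod (p ^ lam k)) // IsCharSub H} ≃o
      {K : AddSubgroup ((Π k : Fin n, ZMod (p ^ lam k)) × ZMod (p ^ lam i)) //
        IsCharSub K}) := by
  have hN : ∀ k, Odd (p ^ lam k) := fun k => (hp.odd_of_ne_two hodd).pow
  have hG : (IsCharSub : AddSubgroup (Π k : Fin n, ZMod (p ^ lam k)) → Prop) =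
      IsFullyInvariantSub :=
    funext fun _ => propext ⟨fun h => h.isFullyInvariantSub_pi hN, fun h => h.isCharSub⟩
  have hGA : (IsCharSub : AddSubgroup ((Π k : Fin n, ZMod (p ^ lam k)) × ZMod (p ^ lam i)) →
      Prop) = IsFullyInvariantSub :=
    funext fun _ => propext
      ⟨fun h => h.isFullyInvariantSub_pi_prod hN (hN i), fun h => h.isCharSub⟩
  rw [hG, hGA]
  exact ⟨fullyInvariantOrderIso (AddMonoidHom.single (fun k => ZMod (p ^ lam k)) i)
    (Pi.evalAddMonoidHom _ i) fun a => by simp⟩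
end
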